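/- The surface-complexity of the 3-sphere S³, of the projective space RP³, of S² × S¹, of the twisted bundle S² ×~ S¹, and of the lens space L(4,1) is zero. -/

import Mathlib

open Set Topology unitInterval

noncomputable section

/-! ### Basic model spaces -/

abbrev R3 : Type := Fin 3 → ℝ
abbrev R2 : Type := Fin 2 → ℝ
abbrev EuclSp (n : ℕ) : Type := EuclideanSpace ℝ (Fin n)

/-- The union of the first `k` coordinate planes in `ℝ³`:
the local models for simple (`k = 1`), double (`k = 2`) and triple (`k = 3`) points. -/
def coordPlanes (k : ℕ) : Set R3 := {x | ∃ i : Fin 3, (i : ℕ) < k ∧ x i = 0}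

abbrev Sphere3 : Type := ↥(Metric.sphere (0 : EuclSp 4) 1)
abbrev Sphere2 : Type := ↥(Metric.sphere (0 : EuclSp 3) 1)
abbrev Circle1 : Type := ↥(Metric.sphere (0 : EuclSp 2) 1)

/-- The antipodal relation on the `n`-sphere. -/
def antipodalRel (n : ℕ) (x y : Metric.sphere (0 : EuclSp (n + 1)) 1) : Prop :=
  (y : EuclSp (n + 1)) = -(x : EuclSp (n + 1))

/-- Real projective `n`-space, as the quotient of the `n`-sphere by the antipodal map. -/
abbrev RP (n : ℕ) : Type := Quot (antipodalRel n)

/-- The unit sphere of `ℂ²`, i.e. the 3-sphere. -/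
abbrev SphereC : Type := Metric.sphere (0 : EuclideanSpace ℂ (Fin 2)) 1

/-- The relation on `S³ ⊆ ℂ²` generating the lens space `L(p,q)`:
`(z₀, z₁) ∼ (ζ z₀, ζ^q z₁)` for `ζ` a `p`-th root of unity. -/
def lensRel (p q : ℕ) (x y : SphereC) : Prop :=
  ∃ k : ℕ,
    (y : EuclideanSpace ℂ (Fin 2)) 0 =
      Complex.exp (2 * Real.pi * Complex.I * k / p) * (x : EuclideanSpace ℂ (Fin 2)) 0 ∧
    (y : EuclideanSpace ℂ (Fin 2)) 1 =
      Complex.exp (2 * Real.pi * Complex.I * (k * q) / p) * (x : EuclideanSpace ℂ (Fin 2)) 1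

/-- The lens space `L(p,q)`. -/
abbrev Lens (p q : ℕ) : Type := Quot (lensRel p q)

/-- The relation generating the twisted bundle `S² ×~ S¹` as a mapping torus of the
antipodal map of `S²`. -/
def twistRel (a b : ↥(Metric.sphere (0 : EuclSp 3) 1) × ℝ) : Prop :=
  ((b.1 : EuclSp 3) = -(a.1 : EuclSp 3)) ∧ b.2 = a.2 + 1

/-- The twisted 2-sphere bundle over the circle, `S² ×~ S¹`. -/
abbrev TwistedS2S1 : Type := Quot twistRel

/-! ### Dehn surfaces -/

/-- `x` has a neighbourhood `U` in `M` in which `Sg` looks like the union of the first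
`k` coordinate planes of `ℝ³`, with `x` corresponding to the origin.  This is the local
model of a point of a Dehn surface with `k` sheets (transversality). -/
def LocalSheets (M : Type) [TopologicalSpace M] (Sg : Set M) (k : ℕ) (x : M) : Prop :=
  ∃ (U : Set M) (_ : IsOpen U) (hx : x ∈ U) (φ : ↥U ≃ₜ R3),
    φ ⟨x, hx⟩ = 0 ∧ (Subtype.val ⁻¹' Sg : Set U) = ⇑φ ⁻¹' coordPlanes k

/-- A Dehn surface in `M`: the image of a transverse immersion of a (possibly disconnected)
closed surface, described via its local models: every point is simple, double or triple. -/
def IsDehnSurface (M : Type) [TopologicalSpace M] (Sg : Set M) : Prop :=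
  IsClosed Sg ∧ Sg.Nonempty ∧ ∀ x ∈ Sg, ∃ k, 1 ≤ k ∧ k ≤ 3 ∧ LocalSheets M Sg k x

/-- The set of triple points of a Dehn surface. -/
def triplePoints (M : Type) [TopologicalSpace M] (Sg : Set M) : Set M :=
  {x | x ∈ Sg ∧ LocalSheets M Sg 3 x}

/-- The set of simple (non-singular) points of a Dehn surface. -/
def simplePoints (M : Type) [TopologicalSpace M] (Sg : Set M) : Set M :=
  {x | x ∈ Sg ∧ LocalSheets M Sg 1 x}

/-- The singular set `S(Σ)` of a Dehn surface: its non-simple points. -/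
def singularSet (M : Type) [TopologicalSpace M] (Sg : Set M) : Set M :=
  Sg \ simplePoints M Sg

/-- Every connected component of `s` is homeomorphic to the model space `T`. -/
def ComponentsHomeo (M : Type) [TopologicalSpace M] (s : Set M) (T : Type)
    [TopologicalSpace T] : Prop :=
  ∀ x ∈ s, Nonempty (↥(connectedComponentIn s x) ≃ₜ T)

/-- A quasi-filling Dehn surface: a Dehn surface whose complement is made up of
(open) balls. -/
def QuasiFilling (M : Type) [TopologicalSpace M] (Sg : Set M) : Prop :=
  IsDehnSurface M Sg ∧ ComponentsHomeo M Sgᶜ R3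

/-- A filling Dehn surface: its singularities induce a cell decomposition of `M`. -/
def Filling (M : Type) [TopologicalSpace M] (Sg : Set M) : Prop :=
  QuasiFilling M Sg ∧ (triplePoints M Sg).Nonempty ∧
  ComponentsHomeo M (singularSet M Sg \ triplePoints M Sg) ℝ ∧
  ComponentsHomeo M (Sg \ singularSet M Sg) R2

/-- The surface-complexity: the minimal number of triple points of a quasi-filling
Dehn surface of `M`. -/
def sc (M : Type) [TopologicalSpace M] : ℕ :=
  sInf {n | ∃ Sg : Set M, QuasiFilling M Sg ∧ (triplePoints M Sg).ncard = n}

/-! ### Embedded surfaces and `P²`-irreducibility -/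

/-- An embedded closed surface in `M` (a Dehn surface all of whose points are simple). -/
def IsEmbeddedClosedSurface (M : Type) [TopologicalSpace M] (F : Set M) : Prop :=
  IsClosed F ∧ F.Nonempty ∧ ∀ x ∈ F, LocalSheets M F 1 x

/-- The surface `F` bounds a ball in `M`. -/
def BoundsABall (M : Type) [TopologicalSpace M] (F : Set M) : Prop :=
  ∃ B : Set M, IsClosed B ∧ frontier B = F ∧
    Nonempty (↥B ≃ₜ ↥(Metric.closedBall (0 : EuclSp 3) 1))

/-- The surface `F` is two-sided in `M` (it has a product neighbourhood). -/
def TwoSided (M : Type) [TopologicalSpace M] (F : Set M) : Prop :=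
  ∃ U : Set M, IsOpen U ∧ F ⊆ U ∧ Nonempty (↥U ≃ₜ ↥F × ℝ)

/-- `M` is `P²`-irreducible: every embedded 2-sphere bounds a ball and `M` contains no
two-sided embedded projective plane. -/
def P2Irreducible (M : Type) [TopologicalSpace M] : Prop :=
  (∀ F : Set M, IsEmbeddedClosedSurface M F → Nonempty (↥F ≃ₜ Sphere2) → BoundsABall M F) ∧
  (∀ F : Set M, IsEmbeddedClosedSurface M F → TwoSided M F → ¬ Nonempty (↥F ≃ₜ RP 2))

end
/-! ### Bubble moves -/

noncomputable section

/-- The local model of the result of a bubble-move: a plane together with a small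
sphere centred at one of its points, meeting it in one circle. -/
def bubbleModel : Set R3 := coordPlanes 1 ∪ Metric.sphere (0 : R3) 1

/-- `Sg'` is obtained from `Sg` by a bubble-move performed inside the open set `U`:
inside `U` a small disc around a simple point is replaced by the bubble model, and
nothing changes outside `U`. -/
def BubbleMoveIn (M : Type) [TopologicalSpace M] (U : Set M) (Sg Sg' : Set M) : Prop :=
  ∃ (_ : IsOpen U) (φ : ↥U ≃ₜ R3),
    (Subtype.val ⁻¹' Sg : Set U) = ⇑φ ⁻¹' coordPlanes 1 ∧
    (Subtype.val ⁻¹' Sg' : Set U) = ⇑φ ⁻¹' bubbleModel ∧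
    Sg' \ U = Sg \ U

/-- `Sg'` is obtained from `Sg` by one bubble-move. -/
def BubbleMove (M : Type) [TopologicalSpace M] (Sg Sg' : Set M) : Prop :=
  ∃ U : Set M, BubbleMoveIn M U Sg Sg'

/-- `Sg` is derived from `Sg₀` by a finite sequence of bubble-moves. -/
def DerivedFrom (M : Type) [TopologicalSpace M] (Sg₀ Sg : Set M) : Prop :=
  Relation.ReflTransGen (BubbleMove M) Sg₀ Sg

/-- A bubble-move avoiding (not involving) the set `D`. -/
def BubbleMoveAvoiding (M : Type) [TopologicalSpace M] (D : Set M) (Sg Sg' : Set M) : Prop :=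
  ∃ U : Set M, Disjoint U D ∧ BubbleMoveIn M U Sg Sg'

/-- `Sg` is derived from `Sg₀` by finitely many bubble-moves, none of which involves `D`. -/
def DerivedFromAvoiding (M : Type) [TopologicalSpace M] (D Sg₀ Sg : Set M) : Prop :=
  Relation.ReflTransGen (BubbleMoveAvoiding M D) Sg₀ Sg

/-! ### Connected sums -/

/-- `N` is a connected sum of `M₁` and `M₂`: it is covered by two closed pieces, glued
along a 2-sphere, respectively homeomorphic to the complements of open balls in `M₁`
and in `M₂`. -/
def IsConnSum (N : Type) [TopologicalSpace N] (M₁ : Type) [TopologicalSpace M₁]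
    (M₂ : Type) [TopologicalSpace M₂] : Prop :=
  ∃ (B₁ : Set M₁) (B₂ : Set M₂) (A₁ A₂ : Set N),
    Nonempty (↥B₁ ≃ₜ ↥(Metric.closedBall (0 : EuclSp 3) 1)) ∧
    Nonempty (↥B₂ ≃ₜ ↥(Metric.closedBall (0 : EuclSp 3) 1)) ∧
    IsClosed A₁ ∧ IsClosed A₂ ∧ A₁ ∪ A₂ = Set.univ ∧
    A₁ ∩ A₂ = frontier A₁ ∧ A₁ ∩ A₂ = frontier A₂ ∧
    Nonempty (↥(A₁ ∩ A₂) ≃ₜ Sphere2) ∧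
    Nonempty (↥A₁ ≃ₜ ↥((interior B₁)ᶜ : Set M₁)) ∧
    Nonempty (↥A₂ ≃ₜ ↥((interior B₂)ᶜ : Set M₂))

/-- `N` is the connected sum of the manifolds `Ms 0, …, Ms n`. -/
def IsConnSumMulti : (n : ℕ) → (Ms : Fin (n + 1) → Type) →
    (tms : ∀ i, TopologicalSpace (Ms i)) → (N : Type) → TopologicalSpace N → Prop
  | 0, Ms, tms, N, tN => Nonempty (@Homeomorph N (Ms 0) tN (tms 0))
  | (n + 1), Ms, tms, N, tN =>
    ∃ (P : Type) (tP : TopologicalSpace P),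
      IsConnSumMulti n (fun i => Ms i.castSucc) (fun i => tms i.castSucc) P tP ∧
      @IsConnSum N tN P tP (Ms (Fin.last (n + 1))) (tms (Fin.last (n + 1)))

end
/-! ### Cubulations and triangulations -/

noncomputable section

abbrev ICube : Type := Fin 3 → ↥unitInterval
abbrev ISquare : Type := Fin 2 → ↥unitInterval
abbrev ISeg : Type := Fin 1 → ↥unitInterval

/-- The open `n`-cube inside the closed one. -/
def openCell (n : ℕ) : Set (Fin n → ↥unitInterval) := {x | ∀ i, x i ≠ 0 ∧ x i ≠ 1}

/-- A cubulation of `M`: a cell decomposition whose 3-cells are cubes, each glued along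
6 faces arranged like the boundary of a cube, each face being glued along 4 edges
(self-adjacencies and multiple adjacencies are allowed).  Cells are given by
characteristic maps which are injective on the open cells, the open cells partition `M`,
and the boundary of every cell is attached through cells of lower dimension. -/
structure Cubulation (M : Type) [TopologicalSpace M] where
  nc : ℕ
  nf : ℕ
  ne : ℕ
  nv : ℕ
  cmap : Fin nc → C(ICube, M)
  fmap : Fin nf → C(ISquare, M)
  emap : Fin ne → C(ISeg, M)
  vmap : Fin nv → M
  cube_injOn : ∀ i, Set.InjOn (cmap i) (openCell 3)
  face_injOn : ∀ i, Set.InjOn (fmap i) (openCell 2)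
  edge_injOn : ∀ i, Set.InjOn (emap i) (openCell 1)
  vert_inj : Function.Injective vmap
  cells_cover : ∀ x : M, (∃ i, x ∈ cmap i '' openCell 3) ∨ (∃ i, x ∈ fmap i '' openCell 2) ∨
      (∃ i, x ∈ emap i '' openCell 1) ∨ (∃ i, x = vmap i)
  cube_disj : ∀ i j, i ≠ j → Disjoint (cmap i '' openCell 3) (cmap j '' openCell 3)
  face_disj : ∀ i j, i ≠ j → Disjoint (fmap i '' openCell 2) (fmap j '' openCell 2)
  edge_disj : ∀ i j, i ≠ j → Disjoint (emap i '' openCell 1) (emap j '' openCell 1)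
  cube_face_disj : ∀ i j, Disjoint (cmap i '' openCell 3) (fmap j '' openCell 2)
  cube_edge_disj : ∀ i j, Disjoint (cmap i '' openCell 3) (emap j '' openCell 1)
  cube_vert_disj : ∀ i j, vmap j ∉ cmap i '' openCell 3
  face_edge_disj : ∀ i j, Disjoint (fmap i '' openCell 2) (emap j '' openCell 1)
  face_vert_disj : ∀ i j, vmap j ∉ fmap i '' openCell 2
  edge_vert_disj : ∀ i j, vmap j ∉ emap i '' openCell 1
  cube_open : ∀ i, IsOpen (cmap i '' openCell 3)
  face_of_cube : ∀ (i : Fin nc) (d : Fin 3) (ε : Bool),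
      ∃ (j : Fin nf) (h : ISquare ≃ₜ ISquare),
        ∀ x : ISquare, cmap i (d.insertNth (if ε then 1 else 0) x) = fmap j (h x)
  edge_of_face : ∀ (i : Fin nf) (d : Fin 2) (ε : Bool),
      ∃ (j : Fin ne) (h : ISeg ≃ₜ ISeg),
        ∀ x : ISeg, fmap i (d.insertNth (if ε then 1 else 0) x) = emap j (h x)
  vert_of_edge : ∀ (i : Fin ne) (ε : Bool), ∃ j : Fin nv,
      emap i (fun _ => if ε then 1 else 0) = vmap j

/-- The interior of the standard simplex. -/
def simplexInt (n : ℕ) : Set ↥(stdSimplex ℝ (Fin n)) := {x | ∀ i, (x : Fin n → ℝ) i ≠ 0}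

/-- A triangulation of a closed 3-manifold `M`, by characteristic maps of tetrahedra,
triangles, edges and vertices: maps are injective on open cells, open cells partition `M`,
and each face of each cell is a cell of lower dimension. -/
structure Triangulation (M : Type) [TopologicalSpace M] where
  nt : ℕ
  nf : ℕ
  ne : ℕ
  nv : ℕ
  tmap : Fin nt → C(↥(stdSimplex ℝ (Fin 4)), M)
  fmap : Fin nf → C(↥(stdSimplex ℝ (Fin 3)), M)
  emap : Fin ne → C(↥(stdSimplex ℝ (Fin 2)), M)
  vmap : Fin nv → M
  t_injOn : ∀ i, Set.InjOn (tmap i) (simplexInt 4)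
  f_injOn : ∀ i, Set.InjOn (fmap i) (simplexInt 3)
  e_injOn : ∀ i, Set.InjOn (emap i) (simplexInt 2)
  v_inj : Function.Injective vmap
  cells_cover : ∀ x : M, (∃ i, x ∈ tmap i '' simplexInt 4) ∨ (∃ i, x ∈ fmap i '' simplexInt 3) ∨
      (∃ i, x ∈ emap i '' simplexInt 2) ∨ (∃ i, x = vmap i)
  t_disj : ∀ i j, i ≠ j → Disjoint (tmap i '' simplexInt 4) (tmap j '' simplexInt 4)
  f_disj : ∀ i j, i ≠ j → Disjoint (fmap i '' simplexInt 3) (fmap j '' simplexInt 3)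
  e_disj : ∀ i j, i ≠ j → Disjoint (emap i '' simplexInt 2) (emap j '' simplexInt 2)
  tf_disj : ∀ i j, Disjoint (tmap i '' simplexInt 4) (fmap j '' simplexInt 3)
  te_disj : ∀ i j, Disjoint (tmap i '' simplexInt 4) (emap j '' simplexInt 2)
  tv_disj : ∀ i j, vmap j ∉ tmap i '' simplexInt 4
  fe_disj : ∀ i j, Disjoint (fmap i '' simplexInt 3) (emap j '' simplexInt 2)
  fv_disj : ∀ i j, vmap j ∉ fmap i '' simplexInt 3
  ev_disj : ∀ i j, vmap j ∉ emap i '' simplexInt 2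
  t_open : ∀ i, IsOpen (tmap i '' simplexInt 4)
  face_t : ∀ (i : Fin nt) (d : Fin 4), ∃ j : Fin nf,
      tmap i '' {x | (x : Fin 4 → ℝ) d = 0} = Set.range (fmap j)
  face_f : ∀ (i : Fin nf) (d : Fin 3), ∃ j : Fin ne,
      fmap i '' {x | (x : Fin 3 → ℝ) d = 0} = Set.range (emap j)
  face_e : ∀ (i : Fin ne) (d : Fin 2), ∃ j : Fin nv,
      emap i '' {x | (x : Fin 2 → ℝ) d = 0} = {vmap j}

end
/-! ### Simple spines and Matveev complexity -/

noncomputable section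

/-- Local model: a plane. -/
def planeModel : Set R3 := {x | x 0 = 0}

/-- Local model: a line. -/
def lineModel : Set R3 := {x | x 0 = 0 ∧ x 1 = 0}

/-- Local model: a point. -/
def pointModel : Set R3 := {(0 : R3)}

/-- Local model: a triple line (three half-planes meeting along a line). -/
def tripleLineModel : Set R3 :=
  {x | (0 ≤ x 0 ∧ x 1 = 0) ∨ (x 0 ≤ 0 ∧ x 1 = x 0) ∨ (x 0 ≤ 0 ∧ x 1 = -x 0)}

/-- The vertices of a regular tetrahedron. -/
def tetraVert : Fin 4 → R3 := ![![1, 1, 1], ![1, -1, -1], ![-1, 1, -1], ![-1, -1, 1]]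

/-- Local model of a vertex of a simple polyhedron: the cone over the 1-skeleton of a
tetrahedron. -/
def spineVertexModel : Set R3 :=
  {x | ∃ i j : Fin 4, i ≠ j ∧ ∃ t : ℝ, 0 ≤ t ∧
    ∃ y ∈ segment ℝ (tetraVert i) (tetraVert j), x = t • y}

/-- `P` looks like the model set `model ⊆ ℝ³` near `x`. -/
def LocalSpineModel (M : Type) [TopologicalSpace M] (P : Set M) (model : Set R3)
    (x : M) : Prop :=
  ∃ (U : Set M) (_ : IsOpen U) (hx : x ∈ U) (φ : ↥U ≃ₜ R3),
    φ ⟨x, hx⟩ = 0 ∧ (Subtype.val ⁻¹' P : Set U) = ⇑φ ⁻¹' model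

/-- A simple polyhedron: the link of every point embeds in the 1-skeleton of the
tetrahedron; equivalently every point has one of the standard local models. -/
def IsSimplePolyhedron (M : Type) [TopologicalSpace M] (P : Set M) : Prop :=
  IsClosed P ∧ P.Nonempty ∧ ∀ x ∈ P,
    LocalSpineModel M P planeModel x ∨ LocalSpineModel M P tripleLineModel x ∨
    LocalSpineModel M P spineVertexModel x ∨ LocalSpineModel M P lineModel x ∨
    LocalSpineModel M P pointModel x

/-- A simple spine of a closed manifold `M`: a simple polyhedron whose complement is
one open ball. -/
def IsSimpleSpine (M : Type) [TopologicalSpace M] (P : Set M) : Prop :=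
  IsSimplePolyhedron M P ∧ IsConnected Pᶜ ∧ ComponentsHomeo M Pᶜ R3

/-- The vertices of a simple polyhedron. -/
def spineVertices (M : Type) [TopologicalSpace M] (P : Set M) : Set M :=
  {x | x ∈ P ∧ LocalSpineModel M P spineVertexModel x}

/-- The Matveev complexity: the minimal number of vertices of a simple spine of `M`. -/
def matveevComplexity (M : Type) [TopologicalSpace M] : ℕ :=
  sInf {n | ∃ P : Set M, IsSimpleSpine M P ∧ (spineVertices M P).ncard = n}

/-! ### Dehn loops on surfaces and loop-complexity -/

/-- The union of the first `k` coordinate lines in `ℝ²`. -/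
def coordLines (k : ℕ) : Set R2 := {x | ∃ i : Fin 2, (i : ℕ) < k ∧ x i = 0}

/-- Local model of a point of a Dehn loop with `k` strands. -/
def LocalStrands (S : Type) [TopologicalSpace S] (G : Set S) (k : ℕ) (x : S) : Prop :=
  ∃ (U : Set S) (_ : IsOpen U) (hx : x ∈ U) (φ : ↥U ≃ₜ R2),
    φ ⟨x, hx⟩ = 0 ∧ (Subtype.val ⁻¹' G : Set U) = ⇑φ ⁻¹' coordLines k

/-- A Dehn loop in the surface `S`: the image of a transverse immersion of a disjoint
union of circles; every point is smooth or a crossing point. -/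
def IsDehnLoop (S : Type) [TopologicalSpace S] (G : Set S) : Prop :=
  IsClosed G ∧ G.Nonempty ∧ ∀ x ∈ G, ∃ k, 1 ≤ k ∧ k ≤ 2 ∧ LocalStrands S G k x

/-- The crossing points of a Dehn loop. -/
def crossingPoints (S : Type) [TopologicalSpace S] (G : Set S) : Set S :=
  {x | x ∈ G ∧ LocalStrands S G 2 x}

/-- A quasi-filling Dehn loop: its complement consists of open discs. -/
def QuasiFillingLoop (S : Type) [TopologicalSpace S] (G : Set S) : Prop :=
  IsDehnLoop S G ∧ ComponentsHomeo S Gᶜ R2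

/-- The loop-complexity of a surface: the minimal number of crossing points of a
quasi-filling Dehn loop. -/
def lc (S : Type) [TopologicalSpace S] : ℕ :=
  sInf {n | ∃ G : Set S, QuasiFillingLoop S G ∧ (crossingPoints S G).ncard = n}

/-- Connected sum of surfaces. -/
def IsConnSum2 (N : Type) [TopologicalSpace N] (M₁ : Type) [TopologicalSpace M₁]
    (M₂ : Type) [TopologicalSpace M₂] : Prop :=
  ∃ (B₁ : Set M₁) (B₂ : Set M₂) (A₁ A₂ : Set N),
    Nonempty (↥B₁ ≃ₜ ↥(Metric.closedBall (0 : EuclSp 2) 1)) ∧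
    Nonempty (↥B₂ ≃ₜ ↥(Metric.closedBall (0 : EuclSp 2) 1)) ∧
    IsClosed A₁ ∧ IsClosed A₂ ∧ A₁ ∪ A₂ = Set.univ ∧
    A₁ ∩ A₂ = frontier A₁ ∧ A₁ ∩ A₂ = frontier A₂ ∧
    Nonempty (↥(A₁ ∩ A₂) ≃ₜ Circle1) ∧
    Nonempty (↥A₁ ≃ₜ ↥((interior B₁)ᶜ : Set M₁)) ∧
    Nonempty (↥A₂ ≃ₜ ↥((interior B₂)ᶜ : Set M₂))

/-- The 2-torus. -/
abbrev Torus2 : Type := Circle1 × Circle1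

/-- `S` is the closed orientable surface of genus `g` (a connected sum of `g` tori). -/
def IsOrientableSurfaceOfGenus : (g : ℕ) → (S : Type) → TopologicalSpace S → Prop
  | 0, S, tS => Nonempty (@Homeomorph S Sphere2 tS _)
  | (g + 1), S, tS =>
    ∃ (P : Type) (tP : TopologicalSpace P),
      IsOrientableSurfaceOfGenus g P tP ∧ @IsConnSum2 S tS P tP Torus2 _

/-- `S` is the closed non-orientable surface of genus `g ≥ 1` (a connected sum of `g`
projective planes). -/
def IsNonorientableSurfaceOfGenus : (g : ℕ) → (S : Type) → TopologicalSpace S → Prop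
  | 0, _, _ => False
  | 1, S, tS => Nonempty (@Homeomorph S (RP 2) tS _)
  | (g + 2), S, tS =>
    ∃ (P : Type) (tP : TopologicalSpace P),
      IsNonorientableSurfaceOfGenus (g + 1) P tP ∧ @IsConnSum2 S tS P tP (RP 2) _

end
/-! ### Special quasi-filling Dehn surfaces -/

noncomputable section

/-- `Sg` is a double projective plane: two embedded projective planes intersecting
along a loop which is non-contractible in both of them. -/
def IsDoubleRP2 (M : Type) [TopologicalSpace M] (Sg : Set M) : Prop :=
  ∃ P₁ P₂ : Set M, Sg = P₁ ∪ P₂ ∧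
    Nonempty (↥P₁ ≃ₜ RP 2) ∧ Nonempty (↥P₂ ≃ₜ RP 2) ∧
    Nonempty (↥(P₁ ∩ P₂) ≃ₜ Circle1) ∧
    (¬ ∃ y : ↥P₁, (⟨Set.inclusion Set.inter_subset_left,
        continuous_inclusion Set.inter_subset_left⟩ : C(↥(P₁ ∩ P₂), ↥P₁)).Homotopic
      (ContinuousMap.const _ y)) ∧
    (¬ ∃ y : ↥P₂, (⟨Set.inclusion Set.inter_subset_right,
        continuous_inclusion Set.inter_subset_right⟩ : C(↥(P₁ ∩ P₂), ↥P₂)).Homotopic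
      (ContinuousMap.const _ y))

/-- `Sg` is a quadruple hat: the image of a disc whose boundary is glued four times
along an embedded circle. -/
def IsQuadrupleHat (M : Type) [TopologicalSpace M] (Sg : Set M) : Prop :=
  ∃ (g : C(↥(Metric.closedBall (0 : ℂ) 1), M)) (h : C(↥(Metric.sphere (0 : ℂ) 1), M)),
    Sg = Set.range g ∧ Function.Injective h ∧
    Set.InjOn g {z : ↥(Metric.closedBall (0 : ℂ) 1) | ‖(z : ℂ)‖ < 1} ∧
    ∀ (z : ℂ) (hz : z ∈ Metric.closedBall (0 : ℂ) 1) (h1 : ‖z‖ = 1),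
      g ⟨z, hz⟩ = h ⟨z ^ 4, by simp [mem_sphere_zero_iff_norm, norm_pow, h1]⟩

/-! ### Heegaard splittings -/

/-- A Heegaard splitting of `M` of genus `g`, together with systems of meridian discs
for both handlebodies: cutting the interior of each handlebody along its meridian discs
gives an open ball. -/
structure HeegaardSplitting (M : Type) [TopologicalSpace M] where
  A : Fin 2 → Set M
  g : ℕ
  D : Fin 2 → Fin g → Set M
  closedA : ∀ j, IsClosed (A j)
  coverA : A 0 ∪ A 1 = Set.univ
  interA0 : A 0 ∩ A 1 = frontier (A 0)
  interA1 : A 0 ∩ A 1 = frontier (A 1)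
  discSub : ∀ j i, D j i ⊆ A j
  discClosed : ∀ j i, IsClosed (D j i)
  discHomeo : ∀ j i, Nonempty (↥(D j i) ≃ₜ ↥(Metric.closedBall (0 : EuclSp 2) 1))
  discDisj : ∀ j, ∀ i i', i ≠ i' → Disjoint (D j i) (D j i')
  meridianCircle : ∀ j i, Nonempty (↥(D j i ∩ (A 0 ∩ A 1)) ≃ₜ Circle1)
  cutBall : ∀ j, Nonempty (↥(interior (A j) \ ⋃ i, D j i) ≃ₜ R3)

/-- The meridian curves of a Heegaard splitting. -/
def HeegaardSplitting.meridian {M : Type} [TopologicalSpace M] (H : HeegaardSplitting M)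
    (j : Fin 2) (i : Fin H.g) : Set M :=
  H.D j i ∩ (H.A 0 ∩ H.A 1)

/-! ### Link diagrams and Dehn surgery -/

/-- Projection to the first two coordinates. -/
def prj (p : R3) : R2 := fun k => p k.castSucc

/-- `u` and `v` are linearly independent in the plane. -/
def det2 (u v : R2) : ℝ := u 0 * v 1 - u 1 * v 0

/-- A link in `ℝ³ ⊆ S³` in regular position with respect to the vertical projection:
`c` components, parametrised periodically and injectively, with regular projection,
at most double points, and transverse crossings. -/
structure LinkDiagram (c : ℕ) where
  γ : Fin c → ℝ → R3
  smooth : ∀ i, ContDiff ℝ 1 (γ i)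
  periodic : ∀ i t, γ i (t + 1) = γ i t
  inj : ∀ i j s t, s ∈ Set.Ico (0 : ℝ) 1 → t ∈ Set.Ico (0 : ℝ) 1 → γ i s = γ j t →
      i = j ∧ s = t
  regular : ∀ i t, prj (deriv (γ i) t) ≠ 0
  atMostTwo : ∀ q : R2,
      {p : Fin c × ℝ | p.2 ∈ Set.Ico (0 : ℝ) 1 ∧ prj (γ p.1 p.2) = q}.ncard ≤ 2
  transverse : ∀ i s j t, s ∈ Set.Ico (0 : ℝ) 1 → t ∈ Set.Ico (0 : ℝ) 1 →
      (i, s) ≠ (j, t) → prj (γ i s) = prj (γ j t) →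
      det2 (prj (deriv (γ i) s)) (prj (deriv (γ j) t)) ≠ 0

/-- The crossing points of the projection of a link diagram. -/
def LinkDiagram.crossings {c : ℕ} (L : LinkDiagram c) : Set R2 :=
  {q | ∃ i s j t, s ∈ Set.Ico (0 : ℝ) 1 ∧ t ∈ Set.Ico (0 : ℝ) 1 ∧
    ((i, s) : Fin c × ℝ) ≠ (j, t) ∧ prj (L.γ i s) = q ∧ prj (L.γ j t) = q}

/-- The component `i` contains an overpass: at some crossing it is the over-strand. -/
def LinkDiagram.hasOverpass {c : ℕ} (L : LinkDiagram c) (i : Fin c) : Prop :=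
  ∃ s j t, s ∈ Set.Ico (0 : ℝ) 1 ∧ t ∈ Set.Ico (0 : ℝ) 1 ∧
    ((i, s) : Fin c × ℝ) ≠ (j, t) ∧ prj (L.γ i s) = prj (L.γ j t) ∧
    L.γ j t 2 < L.γ i s 2

/-- The writhe (blackboard framing) of component `i`: the algebraic count of its
self-crossings. -/
def LinkDiagram.writhe {c : ℕ} (L : LinkDiagram c) (i : Fin c) : ℤ :=
  ({st : ℝ × ℝ | st.1 ∈ Set.Ico (0 : ℝ) 1 ∧ st.2 ∈ Set.Ico (0 : ℝ) 1 ∧ st.1 ≠ st.2 ∧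
      prj (L.γ i st.1) = prj (L.γ i st.2) ∧ L.γ i st.2 2 < L.γ i st.1 2 ∧
      0 < det2 (prj (deriv (L.γ i) st.1)) (prj (deriv (L.γ i) st.2))}.ncard : ℤ) -
  ({st : ℝ × ℝ | st.1 ∈ Set.Ico (0 : ℝ) 1 ∧ st.2 ∈ Set.Ico (0 : ℝ) 1 ∧ st.1 ≠ st.2 ∧
      prj (L.γ i st.1) = prj (L.γ i st.2) ∧ L.γ i st.2 2 < L.γ i st.1 2 ∧
      det2 (prj (deriv (L.γ i) st.1)) (prj (deriv (L.γ i) st.2)) < 0}.ncard : ℤ)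

/-- A point of the boundary circle of the unit disc of `ℂ`. -/
def discBoundaryPt (z : ↥(Metric.sphere (0 : ℂ) 1)) : ↥(Metric.closedBall (0 : ℂ) 1) :=
  ⟨(z : ℂ), Metric.sphere_subset_closedBall z.2⟩

/-- `M` is obtained from `S³ = ℝ³ ∪ {∞}` by Dehn surgery along the link `L`, the
meridian of the `i`-th filling solid torus being glued to the curve `κ i` on the
boundary of a tubular neighbourhood `N i` of the `i`-th component. -/
def SurgeredManifold (M : Type) [TopologicalSpace M] {c : ℕ} (L : LinkDiagram c)
    (κ : Fin c → Set (OnePoint R3)) : Prop :=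
  ∃ N : Fin c → Set (OnePoint R3),
    (∀ i, IsClosed (N i)) ∧
    (∀ i j, i ≠ j → Disjoint (N i) (N j)) ∧
    (∀ i, Nonempty (↥(N i) ≃ₜ ↥(Metric.closedBall (0 : ℂ) 1) × ↥(Metric.sphere (0 : ℂ) 1))) ∧
    (∀ i, (Set.range fun s : ℝ => (OnePoint.some (L.γ i s))) ⊆ interior (N i)) ∧
    (∀ i, κ i ⊆ frontier (N i)) ∧
    ∃ (X : Set M) (V : Fin c → Set M)
      (φ : ↥X ≃ₜ ↥((⋃ i, interior (N i))ᶜ : Set (OnePoint R3))),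
      IsClosed X ∧ (∀ i, IsClosed (V i)) ∧ (X ∪ ⋃ i, V i) = Set.univ ∧
      (∀ i j, i ≠ j → Disjoint (V i) (V j)) ∧ (∀ i, X ∩ V i = frontier (V i)) ∧
      ∀ i, ∃ (ψ : ↥(V i) ≃ₜ ↥(Metric.closedBall (0 : ℂ) 1) × ↥(Metric.sphere (0 : ℂ) 1))
          (u : ↥(Metric.sphere (0 : ℂ) 1))
          (hmer : ∀ z, ((ψ.symm (discBoundaryPt z, u)) : M) ∈ X),
        (Subtype.val '' (⇑φ ''
          (Set.range fun z => (⟨(ψ.symm (discBoundaryPt z, u) : M), hmer z⟩ : ↥X)))) = κ i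

/-- The vertical push-off, realising the blackboard framing. -/
def vertPush (δ : ℝ) (p : R3) : R3 := fun k => if k = 2 then p k + δ else p k

/-- The push-off of the `i`-th component twisted `k` additional times with respect to the
blackboard framing. -/
def framedPush {c : ℕ} (L : LinkDiagram c) (i : Fin c) (k : ℤ) (δ : ℝ) (s : ℝ) : R3 :=
  fun j => L.γ i s j +
    δ * (Real.cos (2 * Real.pi * k * s) * (if j = 2 then 1 else 0) +
      Real.sin (2 * Real.pi * k * s) *
        (if j = 0 then
            -(prj (deriv (L.γ i) s) 1) /
              Real.sqrt (prj (deriv (L.γ i) s) 0 ^ 2 + prj (deriv (L.γ i) s) 1 ^ 2)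
          else if j = 1 then
            prj (deriv (L.γ i) s) 0 /
              Real.sqrt (prj (deriv (L.γ i) s) 0 ^ 2 + prj (deriv (L.γ i) s) 1 ^ 2)
          else 0))

end

noncomputable section

/-! ### Auxiliary material for the proof -/

def WL (ι : Type) (X : Type) [TopologicalSpace X] (S : Set X) (A : Finset ι) (x : X) : Prop :=
  ∃ e : OpenPartialHomeomorph X (ι → ℝ), x ∈ e.source ∧ e x = 0 ∧
    ∀ y ∈ e.source, (y ∈ S ↔ ∃ i ∈ A, e y i = 0)

theorem push_oph {X M Y : Type} [TopologicalSpace X] [TopologicalSpace M] [TopologicalSpace Y]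
    [Nonempty X] (p : X → M) (hc : Continuous p) (ho : IsOpenMap p) (e : OpenPartialHomeomorph X Y)
    (hi : InjOn p e.source) :
    ∃ e' : OpenPartialHomeomorph M Y, e'.source = p '' e.source ∧ e'.target = e.target ∧
      ∀ x ∈ e.source, e' (p x) = e x := by
  let q : OpenPartialHomeomorph X M :=
    OpenPartialHomeomorph.ofContinuousOpenRestrict (hi.toPartialEquiv p e.source)
      hc.continuousOn (ho.domRestrict e.open_source) e.open_source
  have hqs : q.source = e.source := rfl
  have hqt : q.target = p '' e.source := rfl
  have hq : ∀ x, q x = p x := fun _ => rfl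
  refine ⟨q.symm.trans e, ?_, ?_, ?_⟩
  · rw [OpenPartialHomeomorph.trans_source]
    simp only [OpenPartialHomeomorph.symm_source, hqt]
    rw [inter_eq_left]
    intro y hy
    exact q.map_target hy
  · rw [OpenPartialHomeomorph.trans_target]
    rw [inter_eq_left]
    intro y hy
    exact e.map_target hy
  · intro x hx
    have : q.symm (p x) = x := q.left_inv hx
    simp [this]

theorem WL.push {ι X M : Type} [TopologicalSpace X] [TopologicalSpace M]
    (p : X → M) (hc : Continuous p) (ho : IsOpenMap p) (S : Set M) (A : Finset ι) (x : X)
    (V : Set X) (hV : IsOpen V) (hxV : x ∈ V) (hi : InjOn p V)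
    (h : WL ι X (p ⁻¹' S) A x) : WL ι M S A (p x) := by
  obtain ⟨e, hx, h0, hS⟩ := h
  have : Nonempty X := ⟨x⟩
  obtain ⟨e', h1, -, h3⟩ := push_oph p hc ho (e.restrOpen V hV)
    (hi.mono (by intro y hy; exact hy.2))
  refine ⟨e', ?_, ?_, ?_⟩
  · rw [h1]; exact ⟨x, ⟨hx, hxV⟩, rfl⟩
  · rw [h3 x ⟨hx, hxV⟩]; exact h0
  · intro y hy
    rw [h1] at hy
    obtain ⟨z, hz, rfl⟩ := hy
    rw [h3 z hz]
    exact hS z hz.1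

/-- a rescaling permuting coordinates -/
theorem exists_perm {ι : Type} [Fintype ι] (hι : Fintype.card ι = 3) (A : Finset ι) :
    ∃ τ : ι ≃ Fin 3, ∀ i, i ∈ A ↔ (τ i : ℕ) < A.card := by
  classical
  have hA : A.card ≤ 3 := hι ▸ A.card_le_univ
  have h1 : Fintype.card {i // i ∈ A} = Fintype.card {j : Fin 3 // (j : ℕ) < A.card} := by
    rw [Fintype.card_coe]
    generalize A.card = k at hA
    interval_cases k <;> decide
  have e1 := Fintype.equivOfCardEq h1
  have h2 : Fintype.card {i // ¬ i ∈ A} = Fintype.card {j : Fin 3 // ¬ (j : ℕ) < A.card} := by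
    rw [Fintype.card_subtype_compl, Fintype.card_subtype_compl, h1, hι, Fintype.card_fin]
  have e2 := Fintype.equivOfCardEq h2
  refine ⟨((Equiv.sumCompl (fun i => i ∈ A)).symm.trans (Equiv.sumCongr e1 e2)).trans
    (Equiv.sumCompl (fun j : Fin 3 => (j : ℕ) < A.card)), ?_⟩
  intro i
  by_cases hi : i ∈ A
  · simp only [hi, true_iff, Equiv.trans_apply]
    rw [Equiv.sumCompl_symm_apply_of_pos hi]
    exact (e1 ⟨i, hi⟩).2
  · simp only [hi, false_iff, Equiv.trans_apply]
    rw [Equiv.sumCompl_symm_apply_of_neg hi]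
    exact (e2 ⟨i, hi⟩).2

theorem WL.toSheets {ι X : Type} [Fintype ι] [TopologicalSpace X] (hι : Fintype.card ι = 3)
    {S : Set X} {A : Finset ι} {x : X} (h : WL ι X S A x) : LocalSheets X S A.card x := by
  obtain ⟨e, hx, h0, hS⟩ := h
  obtain ⟨τ, hτ⟩ := exists_perm hι A
  obtain ⟨ε, hε, hb⟩ := Metric.isOpen_iff.1 e.open_target 0 (h0 ▸ e.map_source hx)
  let P : (ι → ℝ) ≃ₜ R3 :=
    { toFun := fun f => f ∘ τ.symm
      invFun := fun f => f ∘ τ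
      left_inv := fun f => by ext; simp
      right_inv := fun f => by ext; simp
      continuous_toFun := by fun_prop
      continuous_invFun := by fun_prop }
  let Q : (ι → ℝ) ≃ₜ (ι → ℝ) := Homeomorph.smulOfNeZero ε⁻¹ (by positivity)
  let B : OpenPartialHomeomorph (ι → ℝ) (ι → ℝ) := OpenPartialHomeomorph.univUnitBall.symm
  let F : OpenPartialHomeomorph X R3 :=
    ((e.trans Q.toOpenPartialHomeomorph).trans B).trans P.toOpenPartialHomeomorph
  have hBt : B.target = univ := rfl
  have hBs : B.source = Metric.ball 0 1 := rfl
  have hBapp : ∀ y, B y = (√(1 - ‖y‖ ^ 2 : ℝ))⁻¹ • y := fun y => rfl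
  have hQ : ∀ y, Q y = ε⁻¹ • y := fun y => rfl
  have hFx : ∀ y, F y = P (B (Q (e y))) := fun y => rfl
  have hFs : F.source = e.source ∩ {y | Q (e y) ∈ Metric.ball (0 : ι → ℝ) 1} := by
    ext y; simp [F, hBs]
  have hFt : F.target = univ := by
    rw [eq_univ_iff_forall]
    intro z
    have hz : B.symm (P.symm z) ∈ Metric.ball (0 : ι → ℝ) 1 := B.map_target (hBt ▸ mem_univ _)
    have : Q.symm (B.symm (P.symm z)) ∈ e.target := by
      apply hb
      have : Q.symm (B.symm (P.symm z)) = ε • (B.symm (P.symm z)) := by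
        rw [Homeomorph.symm_apply_eq, hQ, smul_smul, inv_mul_cancel₀ hε.ne', one_smul]
      rw [this, mem_ball_zero_iff, norm_smul, Real.norm_of_nonneg hε.le]
      rw [mem_ball_zero_iff] at hz
      nlinarith
    simpa [F, hBt] using this
  have hxF : x ∈ F.source := by
    rw [hFs]
    refine ⟨hx, ?_⟩
    simp [h0, hQ]
  refine ⟨F.source, F.open_source, hxF, F.toHomeomorphSourceTarget.trans
    ((Homeomorph.setCongr hFt).trans (Homeomorph.Set.univ R3)), ?_, ?_⟩
  · change F x = 0
    rw [hFx, h0, hQ, hBapp]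
    ext i
    simp [P]
  · ext ⟨y, hy⟩
    change y ∈ S ↔ F y ∈ coordPlanes A.card
    rw [hFs] at hy
    rw [hS y hy.1, hFx, hBapp]
    have hpos : (√(1 - ‖Q (e y)‖ ^ 2 : ℝ))⁻¹ ≠ 0 := by
      have h2 : ‖Q (e y)‖ < 1 := by simpa using hy.2
      have h3 : 0 < 1 - ‖Q (e y)‖ ^ 2 := by nlinarith [norm_nonneg (Q (e y))]
      positivity
    have key : ∀ j, P ((√(1 - ‖Q (e y)‖ ^ 2 : ℝ))⁻¹ • Q (e y)) j = 0 ↔ e y (τ.symm j) = 0 := by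
      intro j
      change (√(1 - ‖Q (e y)‖ ^ 2 : ℝ))⁻¹ * (ε⁻¹ * e y (τ.symm j)) = 0 ↔ _
      rw [mul_eq_zero, mul_eq_zero]
      simp [hpos, hε.ne']
    simp only [coordPlanes, mem_ofPred_eq, key]
    constructor
    · rintro ⟨i, hi, h⟩
      exact ⟨τ i, (hτ i).1 hi, by simpa using h⟩
    · rintro ⟨j, hj, h⟩
      exact ⟨τ.symm j, (hτ _).2 (by simpa using hj), h⟩

/-- A point with at most two sheets is not a triple point. -/
theorem not_triple {ι X : Type} [TopologicalSpace X] [Fintype ι]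
    {S : Set X} {A : Finset ι} {x : X} (hA : A.card ≤ 2) (h : WL ι X S A x) :
    ¬ LocalSheets X S 3 x := by
  classical
  rintro ⟨U, hU, hxU, φ, hφ0, hφS⟩
  obtain ⟨e, hx, h0, hS⟩ := h
  have hV : IsOpen (e.source ∩ U) := e.open_source.inter hU
  have hW : IsOpen (e '' (e.source ∩ U)) := e.isOpen_image_of_subset_source hV inter_subset_left
  obtain ⟨ε, hε, hb⟩ := Metric.isOpen_iff.1 hW 0 ⟨x, ⟨hx, hxU⟩, h0⟩
  let D : ((i : ι) → Bool) → Set (ι → ℝ) := fun s =>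
    Metric.ball 0 ε ∩ {y | ∀ i ∈ A, if s i then 0 < y i else y i < 0}
  have hDc : ∀ s, Convex ℝ (D s) := by
    intro s
    refine (convex_ball _ _).inter ?_
    intro a ha b hb t u ht hu htu i hi
    have h1 := ha i hi
    have h2 := hb i hi
    rcases hs : s i
    · simp only [hs, Bool.false_eq_true, if_false, Pi.add_apply, Pi.smul_apply, smul_eq_mul] at *
      rcases ht.eq_or_lt with rfl | ht
      · have : u = 1 := by linarith
        subst this; linarith
      · nlinarith
    · simp only [hs, if_true, Pi.add_apply, Pi.smul_apply, smul_eq_mul] at *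
      rcases ht.eq_or_lt with rfl | ht
      · have : u = 1 := by linarith
        subst this; linarith
      · nlinarith [mul_pos ht h1]
  have hsub : ∀ y ∈ Metric.ball (0 : ι → ℝ) ε, y ∈ e.target ∧ e.symm y ∈ U := by
    intro y hy
    obtain ⟨z, hz, rfl⟩ := hb hy
    exact ⟨e.map_source hz.1, by rw [e.left_inv hz.1]; exact hz.2⟩
  have hVn : IsOpen (Subtype.val ⁻¹' (e.source ∩ e ⁻¹' Metric.ball 0 ε) : Set U) :=
    (e.isOpen_inter_preimage Metric.isOpen_ball).preimage continuous_subtype_val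
  have hVn2 := (φ.isOpenMap _ hVn)
  obtain ⟨δ, hδ, hb2⟩ := Metric.isOpen_iff.1 hVn2 0
    ⟨⟨x, hxU⟩, ⟨hx, by simp [h0, hε]⟩, hφ0⟩
  let oct : (Fin 3 → Bool) → R3 := fun t i => if t i then δ / 2 else - (δ / 2)
  have hoct : ∀ t, ∃ y : U, φ y = oct t ∧ (y : X) ∈ e.source ∧ e y ∈ Metric.ball (0 : ι → ℝ) ε := by
    intro t
    have : oct t ∈ Metric.ball (0 : R3) δ := by
      rw [mem_ball_zero_iff, pi_norm_lt_iff hδ]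
      intro i
      simp only [oct]
      split_ifs <;> simp [abs_of_pos hδ] <;> linarith
    obtain ⟨y, hy, hy2⟩ := hb2 this
    exact ⟨y, hy2, hy.1, hy.2⟩
  choose y hy1 hy2 hy3 using hoct
  have hynS : ∀ t, (y t : X) ∉ S := by
    intro t ht
    have : y t ∈ (Subtype.val ⁻¹' S : Set U) := ht
    rw [hφS] at this
    obtain ⟨i, -, hi⟩ := this
    rw [hy1] at hi
    simp only [oct] at hi
    split_ifs at hi <;> linarith
  let sg : (Fin 3 → Bool) → ({i // i ∈ A} → Bool) := fun t i => decide (0 < e (y t) i)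
  have hcard : Fintype.card ({i // i ∈ A} → Bool) < Fintype.card (Fin 3 → Bool) := by
    rw [Fintype.card_fun, Fintype.card_fun, Fintype.card_coe]
    simp only [Fintype.card_bool, Fintype.card_fin]
    exact Nat.pow_lt_pow_right (by norm_num) (by omega)
  obtain ⟨t, t', htt, hst⟩ := Fintype.exists_ne_map_eq_of_card_lt sg hcard
  apply htt
  let s : ι → Bool := fun i => decide (0 < e (y t) i)
  have hne : ∀ t, ∀ i ∈ A, e (y t) i ≠ 0 := by
    intro t i hi h
    exact hynS t ((hS _ (hy2 t)).2 ⟨i, hi, h⟩)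
  have m1 : e (y t) ∈ D s := by
    refine ⟨hy3 t, fun i hi => ?_⟩
    have := hne t i hi
    simp only [s, decide_eq_true_eq]
    split_ifs with h
    · exact h
    · exact lt_of_le_of_ne (not_lt.1 h) this
  have m2 : e (y t') ∈ D s := by
    refine ⟨hy3 t', fun i hi => ?_⟩
    have := hne t' i hi
    have h4 := congrFun hst ⟨i, hi⟩
    simp only [sg] at h4
    simp only [s, h4, decide_eq_true_eq]
    split_ifs with h
    · exact h
    · exact lt_of_le_of_ne (not_lt.1 h) this
  let T : D s → U := fun z => ⟨e.symm z, (hsub z z.2.1).2⟩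
  have hT : Continuous T := by
    refine Continuous.subtype_mk ?_ _
    exact (e.continuousOn_symm.mono (fun z hz => (hsub z hz.1).1)).domRestrict
  have hTS : ∀ z, (T z : X) ∉ S := by
    intro z hz
    rw [hS _ (e.map_target (hsub z z.2.1).1)] at hz
    obtain ⟨i, hi, h⟩ := hz
    rw [e.right_inv (hsub z z.2.1).1] at h
    have := z.2.2 i hi
    split_ifs at this <;> linarith
  have hpc : PreconnectedSpace (D s) :=
    isPreconnected_iff_preconnectedSpace.1 (hDc s).isPreconnected
  have T1 : T ⟨_, m1⟩ = y t := Subtype.ext (e.left_inv (hy2 t))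
  have T2 : T ⟨_, m2⟩ = y t' := Subtype.ext (e.left_inv (hy2 t'))
  have hnz : ∀ z i, φ (T z) i ≠ 0 := by
    intro z i h
    apply hTS z
    have : T z ∈ (Subtype.val ⁻¹' S : Set U) := by
      rw [hφS]; exact ⟨i, i.2, h⟩
    exact this
  have hcont : ∀ i, Continuous (fun z => φ (T z) i) := fun i =>
    (continuous_apply i).comp (φ.continuous.comp hT)
  funext i
  by_contra hne'
  have hr : IsPreconnected (range (fun z => φ (T z) i)) := isPreconnected_range (hcont i)
  have hoc := hr.ordConnected
  have r1 : oct t i ∈ range (fun z => φ (T z) i) := ⟨⟨_, m1⟩, by simp only [T1, hy1]⟩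
  have r2 : oct t' i ∈ range (fun z => φ (T z) i) := ⟨⟨_, m2⟩, by simp only [T2, hy1]⟩
  have : (0 : ℝ) ∈ range (fun z => φ (T z) i) := by
    rcases h1 : t i <;> rcases h2 : t' i
    · simp [h1, h2] at hne'
    · exact hoc.out r1 r2 ⟨by simp [oct, h1]; linarith, by simp [oct, h2]; linarith⟩
    · exact hoc.out r2 r1 ⟨by simp [oct, h2]; linarith, by simp [oct, h1]; linarith⟩
    · simp [h1, h2] at hne'
  obtain ⟨z, hz⟩ := this
  exact hnz z i hz

end

noncomputable section

theorem main_cover {X M : Type} [TopologicalSpace X] [TopologicalSpace M]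
    (p : X → M) (hc : Continuous p) (ho : IsOpenMap p) (hp : Function.Surjective p)
    (S : Set X) (hSc : IsClosed S) (hSn : S.Nonempty)
    (hsat : ∀ a b, p a = p b → a ∈ S → b ∈ S)
    (hloc : ∀ x ∈ S, ∃ V : Set X, IsOpen V ∧ x ∈ V ∧ InjOn p V)
    (ι : Type) [Fintype ι] (hι : Fintype.card ι = 3)
    (hWL : ∀ x ∈ S, ∃ A : Finset ι, A.card ≤ 2 ∧ WL ι X S A x)
    (J : Type) (C : J → OpenPartialHomeomorph X R3) (hCt : ∀ j, (C j).target = univ)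
    (hCi : ∀ j, InjOn p (C j).source)
    (hcov : ∀ x, x ∉ S → ∃ j, ∃ y ∈ (C j).source, p y = p x)
    (hsub : ∀ j, ∀ y ∈ (C j).source, y ∉ S)
    (hdisj : ∀ i j, ∀ x ∈ (C i).source, ∀ y ∈ (C j).source, p x = p y → i = j) :
    sc M = 0 := by
  have hne : Nonempty X := ⟨hSn.choose⟩
  have hpre : p ⁻¹' (p '' S) = S := by
    apply Subset.antisymm _ (subset_preimage_image p S)
    rintro x ⟨y, hy, hyx⟩
    exact hsat y x hyx hy
  have hcompl : (p '' S)ᶜ = p '' Sᶜ := by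
    ext m
    obtain ⟨x, rfl⟩ := hp m
    constructor
    · intro h
      exact ⟨x, fun hx => h ⟨x, hx, rfl⟩, rfl⟩
    · rintro ⟨y, hy, hyx⟩ ⟨z, hz, hzx⟩
      exact hy (hsat z y (hzx.trans hyx.symm) hz)
  have hW : ∀ m ∈ p '' S, ∃ A : Finset ι, A.card ≤ 2 ∧ WL ι M (p '' S) A m := by
    rintro m ⟨x, hx, rfl⟩
    obtain ⟨A, hA, hw⟩ := hWL x hx
    obtain ⟨V, hV, hxV, hi⟩ := hloc x hx
    exact ⟨A, hA, WL.push p hc ho _ A x V hV hxV hi (by rw [hpre]; exact hw)⟩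
  have hcomp : ComponentsHomeo M (p '' S)ᶜ R3 := by
    intro m hm
    have hm' := hm
    rw [hcompl] at hm'
    obtain ⟨x, hx, rfl⟩ := hm'
    obtain ⟨j, y, hy, hyx⟩ := hcov x hx
    have hsubj : ∀ k, p '' (C k).source ⊆ (p '' S)ᶜ := by
      intro k
      rw [hcompl]
      exact image_mono (fun z hz => hsub k z hz)
    obtain ⟨e, he1, he2, -⟩ := push_oph p hc ho (C j) (hCi j)
    have hom : ↥(p '' (C j).source) ≃ₜ R3 := (Homeomorph.setCongr he1.symm).trans
      (e.toHomeomorphSourceTarget.trans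
        ((Homeomorph.setCongr (he2.trans (hCt j))).trans (Homeomorph.Set.univ R3)))
    have hpx : p x ∈ p '' (C j).source := ⟨y, hy, hyx⟩
    have hpc : IsPreconnected (p '' (C j).source) := by
      rw [isPreconnected_iff_preconnectedSpace]
      exact hom.symm.surjective.denseRange.preconnectedSpace hom.symm.continuous
    have heq : connectedComponentIn (p '' S)ᶜ (p x) = p '' (C j).source := by
      apply Subset.antisymm
      · apply IsPreconnected.subset_left_of_subset_union (u := p '' (C j).source)
          (v := ⋃ k ∈ {k | k ≠ j}, p '' (C k).source)
        · exact ho _ (C j).open_source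
        · exact isOpen_biUnion fun k _ => ho _ (C k).open_source
        · rw [Set.disjoint_left]
          rintro _ ⟨a, ha, rfl⟩ hb
          simp only [mem_iUnion] at hb
          obtain ⟨k, hk, b, hb, hab⟩ := hb
          exact hk (hdisj k j b hb a ha hab)
        · intro z hz
          have hz2 := connectedComponentIn_subset _ _ hz
          rw [hcompl] at hz2
          obtain ⟨w, hw, rfl⟩ := hz2
          obtain ⟨k, v, hv, hvw⟩ := hcov w hw
          by_cases hk : k = j
          · subst hk
            exact Or.inl ⟨v, hv, hvw⟩
          · right
            simp only [mem_iUnion]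
            exact ⟨k, hk, v, hv, hvw⟩
        · exact ⟨p x, mem_connectedComponentIn hm, hpx⟩
        · exact isPreconnected_connectedComponentIn
      · exact hpc.subset_connectedComponentIn hpx (hsubj j)
    rw [heq]
    exact ⟨hom⟩
  unfold sc
  rw [Nat.sInf_eq_zero]
  left
  refine ⟨p '' S, ⟨⟨?_, hSn.image p, ?_⟩, hcomp⟩, ?_⟩
  · rw [← isOpen_compl_iff, hcompl]
    exact ho _ hSc.isOpen_compl
  · intro m hm
    obtain ⟨A, hA, hw⟩ := hW m hm
    refine ⟨A.card, ?_, by omega, hw.toSheets hι⟩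
    obtain ⟨e, hx, -, hS⟩ := hw
    obtain ⟨i, hi, -⟩ := (hS m hx).1 hm
    exact Finset.card_pos.2 ⟨i, hi⟩
  · have : triplePoints M (p '' S) = ∅ := by
      rw [eq_empty_iff_forall_notMem]
      rintro m ⟨hm, h3⟩
      obtain ⟨A, hA, hw⟩ := hW m hm
      exact not_triple hA hw h3
    rw [this, ncard_empty]

/-- Central projection of a coordinate hemisphere. -/
def hemi (n : ℕ) (i : Fin (n + 1)) (ε : ℝ) (hε : ε ^ 2 = 1) :
    OpenPartialHomeomorph (Metric.sphere (0 : EuclSp (n + 1)) 1) (Fin n → ℝ) where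
  toFun x := fun j => (x : EuclSp (n + 1)) (i.succAbove j) / (x : EuclSp (n + 1)) i
  invFun y := ⟨WithLp.toLp 2 (fun k => ε / √(1 + ∑ j, y j ^ 2) *
      (i.insertNth (1 : ℝ) y : Fin (n + 1) → ℝ) k), by
    have hpos : 0 < 1 + ∑ j, y j ^ 2 := by positivity
    rw [mem_sphere_zero_iff_norm, EuclideanSpace.norm_eq, Real.sqrt_eq_one]
    simp only [Real.norm_eq_abs, sq_abs, mul_pow]
    rw [← Finset.mul_sum, Fin.sum_univ_succAbove _ i]
    simp only [Fin.insertNth_apply_same, Fin.insertNth_apply_succAbove, div_pow, hε,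
      Real.sq_sqrt hpos.le, one_pow]
    field_simp⟩
  source := {x | 0 < ε * (x : EuclSp (n + 1)) i}
  target := univ
  map_source' _ _ := mem_univ _
  map_target' y _ := by
    have hpos : 0 < 1 + ∑ j, y j ^ 2 := by positivity
    simp only [mem_ofPred_eq, Fin.insertNth_apply_same, mul_one]
    rw [← mul_div_assoc, ← sq, hε]
    positivity
  left_inv' x hx := by
    have hx0 : 0 < ε * (x : EuclSp (n + 1)) i := hx
    have hn := x.2
    rw [mem_sphere_zero_iff_norm, EuclideanSpace.norm_eq, Real.sqrt_eq_one,
      Fin.sum_univ_succAbove _ i] at hn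
    simp only [Real.norm_eq_abs, sq_abs] at hn
    have hxi : (x : EuclSp (n + 1)) i ≠ 0 := by
      intro h; rw [h] at hx0; simp at hx0
    have hs : √(1 + ∑ j, ((x : EuclSp (n + 1)) (i.succAbove j) / (x : EuclSp (n + 1)) i) ^ 2)
        = (ε * (x : EuclSp (n + 1)) i)⁻¹ := by
      rw [Real.sqrt_eq_iff_mul_self_eq_of_pos (inv_pos.2 hx0)]
      simp only [div_pow]
      rw [← Finset.sum_div]
      have : ∑ j, (x : EuclSp (n + 1)) (i.succAbove j) ^ 2 = 1 - (x : EuclSp (n + 1)) i ^ 2 := by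
        linarith
      rw [this, ← mul_inv, ← sq, mul_pow, hε]
      field_simp
      ring
    apply Subtype.ext
    ext k
    simp only [hs]
    have hεε : ε * ε = 1 := by rw [← sq, hε]
    rcases Fin.eq_self_or_eq_succAbove i k with rfl | ⟨j, rfl⟩
    · simp only [Fin.insertNth_apply_same]
      rw [div_inv_eq_mul, ← mul_assoc, hεε]; ring
    · simp only [Fin.insertNth_apply_succAbove]
      rw [div_inv_eq_mul, ← mul_assoc, hεε]; field_simp
  right_inv' y _ := by
    have hpos : 0 < 1 + ∑ j, y j ^ 2 := by positivity
    have hε0 : ε ≠ 0 := by rintro rfl; simp at hε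
    have : ε / √(1 + ∑ j, y j ^ 2) ≠ 0 := div_ne_zero hε0 (Real.sqrt_pos.2 hpos).ne'
    funext j
    simp only [Fin.insertNth_apply_same, Fin.insertNth_apply_succAbove]
    rw [mul_one, mul_div_cancel_left₀ _ this]
  open_source := by
    apply isOpen_lt continuous_const
    fun_prop
  open_target := isOpen_univ
  continuousOn_toFun := by
    have : ∀ x ∈ {x : Metric.sphere (0 : EuclSp (n + 1)) 1 | 0 < ε * (x : EuclSp (n + 1)) i},
      (x : EuclSp (n + 1)) i ≠ 0 := by
      intro x hx h
      simp [h] at hx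
    apply continuousOn_pi.2
    intro j
    exact ContinuousOn.div (by fun_prop) (by fun_prop) this
  continuousOn_invFun := by
    apply Continuous.continuousOn
    apply Continuous.subtype_mk
    apply (PiLp.continuous_toLp 2 _).comp
    apply continuous_pi
    intro k
    apply Continuous.mul
    · apply Continuous.div continuous_const
      · fun_prop
      · intro y
        have hpos : 0 < 1 + ∑ j, y j ^ 2 := by positivity
        exact (Real.sqrt_pos.2 hpos).ne'
    · rcases Fin.eq_self_or_eq_succAbove i k with rfl | ⟨j, rfl⟩
      · simp only [Fin.insertNth_apply_same]; fun_prop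
      · simp only [Fin.insertNth_apply_succAbove]; fun_prop

theorem hemi_apply (n : ℕ) (i : Fin (n + 1)) (ε : ℝ) (hε : ε ^ 2 = 1)
    (x : Metric.sphere (0 : EuclSp (n + 1)) 1) (j : Fin n) :
    hemi n i ε hε x j = (x : EuclSp (n + 1)) (i.succAbove j) / (x : EuclSp (n + 1)) i := rfl

/-- Union of coordinate subspheres. -/
def coordSph (n : ℕ) (B : Finset (Fin (n + 1))) : Set (Metric.sphere (0 : EuclSp (n + 1)) 1) :=
  {x | ∃ c ∈ B, (x : EuclSp (n + 1)) c = 0}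

theorem coordSph_closed (n : ℕ) (B : Finset (Fin (n + 1))) : IsClosed (coordSph n B) := by
  have : coordSph n B = ⋃ c ∈ B, {x : Metric.sphere (0 : EuclSp (n + 1)) 1 | (x : EuclSp (n + 1)) c = 0} := by
    ext x; simp [coordSph]
  rw [this]
  apply B.finite_toSet.isClosed_biUnion
  intro c _
  exact isClosed_eq (by fun_prop) continuous_const

theorem exists_coord_ne (n : ℕ) (x : Metric.sphere (0 : EuclSp (n + 1)) 1) :
    ∃ i, (x : EuclSp (n + 1)) i ≠ 0 := by
  by_contra! h
  have : (x : EuclSp (n + 1)) = 0 := by ext i; simpa using h i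
  have h2 := x.2
  rw [mem_sphere_zero_iff_norm, this] at h2
  simp at h2

theorem WL_sphere (n : ℕ) (B : Finset (Fin (n + 1))) (x : Metric.sphere (0 : EuclSp (n + 1)) 1) :
    ∃ A : Finset (Fin n), A.card ≤ B.card ∧
      WL (Fin n) (Metric.sphere (0 : EuclSp (n + 1)) 1) (coordSph n B) A x := by
  classical
  obtain ⟨i, hi⟩ := exists_coord_ne n x
  obtain ⟨ε, hε, hpos⟩ : ∃ ε : ℝ, ε ^ 2 = 1 ∧ 0 < ε * (x : EuclSp (n + 1)) i := by
    rcases lt_or_gt_of_ne hi with h | h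
    · exact ⟨-1, by norm_num, by linarith⟩
    · exact ⟨1, by norm_num, by linarith⟩
  let A : Finset (Fin n) := Finset.univ.filter
    (fun j => i.succAbove j ∈ B ∧ (x : EuclSp (n + 1)) (i.succAbove j) = 0)
  have hA : ∀ j, j ∈ A ↔ i.succAbove j ∈ B ∧ (x : EuclSp (n + 1)) (i.succAbove j) = 0 := by
    intro j; simp [A]
  refine ⟨A, ?_, ?_⟩
  · apply Finset.card_le_card_of_injOn i.succAbove
    · intro j hj; exact ((hA j).1 hj).1
    · exact Fin.succAbove_right_injective.injOn
  let V : Set (Metric.sphere (0 : EuclSp (n + 1)) 1) :=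
    {y | ∀ c, (x : EuclSp (n + 1)) c ≠ 0 → (y : EuclSp (n + 1)) c ≠ 0}
  have hV : IsOpen V := by
    have : V = ⋂ c ∈ {c | (x : EuclSp (n + 1)) c ≠ 0},
        {y : Metric.sphere (0 : EuclSp (n + 1)) 1 | (y : EuclSp (n + 1)) c ≠ 0} := by
      ext y; simp [V]
    rw [this]
    apply (Set.toFinite _).isOpen_biInter
    intro c _
    exact isOpen_ne_fun (by fun_prop) continuous_const
  let e := hemi n i ε hε
  refine ⟨(e.restrOpen V hV).trans (Homeomorph.addRight (-(e x))).toOpenPartialHomeomorph,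
    ?_, ?_, ?_⟩
  · simp only [OpenPartialHomeomorph.trans_source, OpenPartialHomeomorph.restrOpen_source,
      Homeomorph.toOpenPartialHomeomorph_source, preimage_univ, inter_univ]
    exact ⟨hpos, fun c h => h⟩
  · change e x + -(e x) = 0
    simp
  · intro y hy
    simp only [OpenPartialHomeomorph.trans_source, OpenPartialHomeomorph.restrOpen_source,
      Homeomorph.toOpenPartialHomeomorph_source, preimage_univ, inter_univ] at hy
    have hyi : (y : EuclSp (n + 1)) i ≠ 0 := hy.2 i hi
    have key : ∀ j ∈ A, (((e.restrOpen V hV).trans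
        (Homeomorph.addRight (-(e x))).toOpenPartialHomeomorph) y j = 0 ↔
        (y : EuclSp (n + 1)) (i.succAbove j) = 0) := by
      intro j hj
      change e y j + -(e x j) = 0 ↔ _
      simp only [e, hemi_apply, ((hA j).1 hj).2]
      simp [hyi]
    constructor
    · rintro ⟨c, hc, h⟩
      have hxc : (x : EuclSp (n + 1)) c = 0 := by
        by_contra hne
        exact hy.2 c hne h
      rcases Fin.eq_self_or_eq_succAbove i c with rfl | ⟨j, rfl⟩
      · exact absurd hxc hi
      · have hj := (hA j).2 ⟨hc, hxc⟩
        exact ⟨j, hj, (key j hj).2 h⟩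
    · rintro ⟨j, hj, h⟩
      exact ⟨_, ((hA j).1 hj).1, (key j hj).1 h⟩

theorem WL.prod {ι κ X Y : Type} [TopologicalSpace X] [TopologicalSpace Y]
    {S : Set X} {T : Set Y} {A : Finset ι} {B : Finset κ} {x : X} {y : Y}
    (hx : WL ι X S A x) (hy : WL κ Y T B y) :
    WL (ι ⊕ κ) (X × Y) {z | z.1 ∈ S ∨ z.2 ∈ T} (A.disjSum B) (x, y) := by
  obtain ⟨e, he, he0, hS⟩ := hx
  obtain ⟨f, hf, hf0, hT⟩ := hy
  let H : ((ι → ℝ) × (κ → ℝ)) ≃ₜ (ι ⊕ κ → ℝ) :=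
    { toFun := fun z => Sum.elim z.1 z.2
      invFun := fun z => (fun i => z (Sum.inl i), fun i => z (Sum.inr i))
      left_inv := fun z => rfl
      right_inv := fun z => by ext (i | i) <;> rfl
      continuous_toFun := by
        apply continuous_pi
        rintro (i | i) <;> simp only [Sum.elim_inl, Sum.elim_inr] <;> fun_prop
      continuous_invFun := by fun_prop }
  refine ⟨(e.prod f).trans H.toOpenPartialHomeomorph, ?_, ?_, ?_⟩
  · simp [he, hf]
  · change Sum.elim (e x) (f y) = 0
    rw [he0, hf0]
    ext (i | i) <;> rfl
  · rintro ⟨a, b⟩ hab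
    have hab' : a ∈ e.source ∧ b ∈ f.source := by simpa using hab
    have : ∀ i, ((e.prod f).trans H.toOpenPartialHomeomorph) (a, b) i
        = Sum.elim (e a) (f b) i := fun i => rfl
    simp only [mem_ofPred_eq, hS a hab'.1, hT b hab'.2, this, Sum.exists]
    simp

theorem WL_int (t : ℝ) : ∃ A : Finset Unit, A.card ≤ 1 ∧
    WL Unit ℝ (range (fun n : ℤ => (n : ℝ))) A t := by
  have hcl : IsClosed (range (fun n : ℤ => (n : ℝ))) := Int.isClosedEmbedding_coe_real.isClosed_range
  let H : ℝ ≃ₜ (Unit → ℝ) :=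
    (Homeomorph.addRight (-t)).trans (Homeomorph.funUnique Unit ℝ).symm
  have hH : ∀ s i, H s i = s + -t := fun s i => rfl
  by_cases ht : t ∈ range (fun n : ℤ => (n : ℝ))
  · obtain ⟨n, hn⟩ := ht
    simp only at hn
    subst hn
    refine ⟨{()}, by simp, H.toOpenPartialHomeomorph.restrOpen (Ioo (n - 1 : ℝ) (n + 1)) isOpen_Ioo,
      ?_, ?_, ?_⟩
    · simp
    · ext i; change H _ i = 0; rw [hH]; simp
    · intro y hy
      have hy' : (n - 1 : ℝ) < y ∧ y < n + 1 := by simpa using hy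
      have : ∀ i, (H.toOpenPartialHomeomorph.restrOpen (Ioo (n - 1 : ℝ) (n + 1)) isOpen_Ioo) y i
        = y + -n := fun i => rfl
      simp only [this, Finset.mem_singleton]
      constructor
      · rintro ⟨m, rfl⟩
        obtain ⟨h1, h2⟩ := hy'
        simp only at h1 h2
        have h1' : n - 1 < m := by exact_mod_cast h1
        have h2' : m < n + 1 := by exact_mod_cast h2
        have : m = n := by omega
        exact ⟨(), trivial, by simp [this]⟩
      · rintro ⟨_, _, h⟩
        exact ⟨n, by simp only; linarith⟩
  · refine ⟨∅, by simp, H.toOpenPartialHomeomorph.restrOpen _ hcl.isOpen_compl, ?_, ?_, ?_⟩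
    · simpa using ht
    · ext i; change H _ i = 0; rw [hH]; simp
    · intro y hy
      have hy' : y ∉ range (fun n : ℤ => (n : ℝ)) := hy.2
      simp only [hy', false_iff]
      simp

/-! ### Cyclic quotients -/

theorem quot_iff {X : Type} [TopologicalSpace X] (r : X → X → Prop) (g : X ≃ₜ X)
    (h1 : ∀ a b, r a b → ∃ k : ℤ, b = (g ^ k) a) (h2 : ∀ a, r a (g a)) (a b : X) :
    Quot.mk r a = Quot.mk r b ↔ ∃ k : ℤ, b = (g ^ k) a := by
  constructor
  · intro h
    have h' := Quot.eqvGen_exact h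
    induction h' with
    | rel x y hxy => exact h1 x y hxy
    | refl x => exact ⟨0, by simp⟩
    | symm x y _ ih =>
      obtain ⟨k, rfl⟩ := ih (Quot.eqvGen_sound ‹_›)
      refine ⟨-k, ?_⟩
      rw [← Homeomorph.mul_apply, ← zpow_add]; simp
    | trans x y z _ _ ih1 ih2 =>
      obtain ⟨k, rfl⟩ := ih1 (Quot.eqvGen_sound ‹_›)
      obtain ⟨l, rfl⟩ := ih2 (Quot.eqvGen_sound ‹_›)
      refine ⟨l + k, ?_⟩
      rw [← Homeomorph.mul_apply, ← zpow_add]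
  · have hs : ∀ a, Quot.mk r (g a) = Quot.mk r a := fun a => (Quot.sound (h2 a)).symm
    have key : ∀ k : ℤ, ∀ a, Quot.mk r ((g ^ k) a) = Quot.mk r a := by
      intro k
      induction k using Int.induction_on with
      | zero => intro a; simp
      | succ n ih => intro a; rw [zpow_add_one, Homeomorph.mul_apply, ih, hs]
      | pred n ih =>
        intro a
        rw [zpow_sub_one, Homeomorph.mul_apply, ih, ← hs (g⁻¹ a), ← Homeomorph.mul_apply]
        simp
    rintro ⟨k, rfl⟩
    exact (key k a).symm

theorem quot_open {X : Type} [TopologicalSpace X] (r : X → X → Prop) (g : X ≃ₜ X)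
    (h1 : ∀ a b, r a b → ∃ k : ℤ, b = (g ^ k) a) (h2 : ∀ a, r a (g a)) :
    IsOpenMap (Quot.mk r) := by
  intro U hU
  rw [← isQuotientMap_quot_mk.isOpen_preimage]
  have : Quot.mk r ⁻¹' (Quot.mk r '' U) = ⋃ k : ℤ, (g ^ k) '' U := by
    ext x
    simp only [mem_preimage, mem_image, mem_iUnion]
    constructor
    · rintro ⟨y, hy, h⟩
      obtain ⟨k, hk⟩ := (quot_iff r g h1 h2 y x).1 h
      exact ⟨k, y, hy, hk.symm⟩
    · rintro ⟨k, y, hy, h⟩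
      exact ⟨y, hy, (quot_iff r g h1 h2 y x).2 ⟨k, h.symm⟩⟩
  rw [this]
  exact isOpen_iUnion fun k => (g ^ k).isOpenMap _ hU

end

noncomputable section

abbrev Sgn : Type := {ε : ℝ // ε ^ 2 = 1}

theorem sgn_cases (ε : ℝ) (h : ε ^ 2 = 1) : ε = 1 ∨ ε = -1 := by
  have : (ε - 1) * (ε + 1) = 0 := by linarith
  rcases mul_eq_zero.1 this with h | h
  · left; linarith
  · right; linarith

theorem sgn_unique {ε δ : Sgn} {x : ℝ} (h1 : 0 < (ε : ℝ) * x) (h2 : 0 < (δ : ℝ) * x) : ε = δ := by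
  apply Subtype.ext
  rcases sgn_cases _ ε.2 with h | h <;> rcases sgn_cases _ δ.2 with h' | h' <;>
    rw [h, h'] <;> rw [h] at h1 <;> rw [h'] at h2 <;> linarith

theorem sgn_exists {x : ℝ} (hx : x ≠ 0) : ∃ ε : Sgn, 0 < (ε : ℝ) * x := by
  rcases lt_or_gt_of_ne hx with h | h
  · exact ⟨⟨-1, by norm_num⟩, by simpa using h⟩
  · exact ⟨⟨1, by norm_num⟩, by simpa using h⟩

theorem mem_coordSph_zero {n : ℕ} {x : Metric.sphere (0 : EuclSp (n + 1)) 1} :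
    x ∈ coordSph n {0} ↔ (x : EuclSp (n + 1)) 0 = 0 := by
  simp [coordSph]

/-- A standard basis vector as a point of the sphere. -/
def basisPt (n : ℕ) (i : Fin (n + 1)) : Metric.sphere (0 : EuclSp (n + 1)) 1 :=
  ⟨EuclideanSpace.single i 1, by simp⟩

theorem basisPt_ne {n : ℕ} {i j : Fin (n + 1)} (h : j ≠ i) :
    (basisPt n i : EuclSp (n + 1)) j = 0 := by
  simp [basisPt, h]

theorem sc_sphere : sc Sphere3 = 0 := by
  refine main_cover (X := Sphere3) id continuous_id IsOpenMap.id Function.surjective_id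
    (coordSph 3 {0}) (coordSph_closed _ _)
    ⟨basisPt 3 1, mem_coordSph_zero.2 (basisPt_ne (by decide))⟩
    (by rintro a b rfl h; exact h) (fun x _ => ⟨univ, isOpen_univ, mem_univ _, Set.injOn_id _⟩)
    (Fin 3) (by simp) ?_ Sgn (fun ε => hemi 3 0 ε.1 ε.2) (fun _ => rfl) (fun _ => Set.injOn_id _)
    ?_ ?_ ?_
  · intro x _
    obtain ⟨A, hA, h⟩ := WL_sphere 3 {0} x
    exact ⟨A, hA.trans (by simp), h⟩
  · intro x hx
    rw [mem_coordSph_zero] at hx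
    obtain ⟨ε, h⟩ := sgn_exists hx
    exact ⟨ε, x, h, rfl⟩
  · intro ε y hy h
    rw [mem_coordSph_zero] at h
    have hy' : 0 < (ε : ℝ) * (y : EuclSp 4) 0 := hy
    rw [h] at hy'
    simp at hy'
  · rintro ε δ x hx y hy rfl
    exact sgn_unique (x := (x : EuclSp 4) 0) hx hy

theorem antip_zpow {n : ℕ} (k : ℤ) (a : Metric.sphere (0 : EuclSp (n + 1)) 1) :
    ((Homeomorph.neg (Metric.sphere (0 : EuclSp (n + 1)) 1)) ^ k) a = a ∨
    ((Homeomorph.neg (Metric.sphere (0 : EuclSp (n + 1)) 1)) ^ k) a = -a := by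
  have h2 : (Homeomorph.neg (Metric.sphere (0 : EuclSp (n + 1)) 1)) ^ (2 : ℤ) = 1 := by
    ext1 x
    rw [zpow_ofNat, sq, Homeomorph.mul_apply]
    simp
  rcases Int.even_or_odd' k with ⟨m, rfl | rfl⟩
  · left; rw [zpow_mul, h2]; simp
  · right; rw [zpow_add, zpow_mul, h2]; simp

theorem antip_iff {n : ℕ} (a b : Metric.sphere (0 : EuclSp (n + 1)) 1) :
    Quot.mk (antipodalRel n) a = Quot.mk (antipodalRel n) b ↔ b = a ∨ b = -a := by
  rw [quot_iff (antipodalRel n) (Homeomorph.neg _)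
    (fun a b h => ⟨1, by rw [zpow_one]; exact Subtype.ext h⟩) (fun a => rfl)]
  constructor
  · rintro ⟨k, rfl⟩
    exact antip_zpow k a
  · rintro (rfl | rfl)
    · exact ⟨0, by simp⟩
    · exact ⟨1, by simp⟩

theorem antip_open (n : ℕ) : IsOpenMap (Quot.mk (antipodalRel n)) :=
  quot_open (antipodalRel n) (Homeomorph.neg _)
    (fun a b h => ⟨1, by rw [zpow_one]; exact Subtype.ext h⟩) (fun a => rfl)

theorem neg_coe_apply {n : ℕ} (x : Metric.sphere (0 : EuclSp (n + 1)) 1) (i : Fin (n + 1)) :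
    ((-x : Metric.sphere (0 : EuclSp (n + 1)) 1) : EuclSp (n + 1)) i = -(x : EuclSp (n + 1)) i := by
  simp

theorem antip_inj (n : ℕ) (i : Fin (n + 1)) (ε : Sgn) :
    InjOn (Quot.mk (antipodalRel n)) (hemi n i ε.1 ε.2).source := by
  intro a ha b hb h
  rw [antip_iff] at h
  rcases h with rfl | rfl
  · rfl
  · have ha' : 0 < (ε : ℝ) * (a : EuclSp (n + 1)) i := ha
    have hb' : 0 < (ε : ℝ) * ((-a : Metric.sphere (0 : EuclSp (n + 1)) 1) : EuclSp (n + 1)) i := hb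
    rw [neg_coe_apply] at hb'
    linarith

theorem sc_RP3 : sc (RP 3) = 0 := by
  refine main_cover (X := Sphere3) (Quot.mk (antipodalRel 3)) continuous_quot_mk (antip_open 3)
    Quot.mk_surjective
    (coordSph 3 {0}) (coordSph_closed _ _)
    ⟨basisPt 3 1, mem_coordSph_zero.2 (basisPt_ne (by decide))⟩
    ?_ ?_
    (Fin 3) (by simp) ?_ Unit (fun _ => hemi 3 0 1 (by norm_num)) (fun _ => rfl)
    (fun _ => antip_inj 3 0 ⟨1, by norm_num⟩)
    ?_ ?_ ?_
  · intro a b hab ha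
    rw [antip_iff] at hab
    rw [mem_coordSph_zero] at ha ⊢
    rcases hab with rfl | rfl
    · exact ha
    · rw [neg_coe_apply, ha, neg_zero]
  · intro x _
    obtain ⟨i, hi⟩ := exists_coord_ne 3 x
    obtain ⟨ε, h⟩ := sgn_exists hi
    exact ⟨_, (hemi 3 i ε.1 ε.2).open_source, h, antip_inj 3 i ε⟩
  · intro x _
    obtain ⟨A, hA, h⟩ := WL_sphere 3 {0} x
    exact ⟨A, hA.trans (by simp), h⟩
  · intro x hx
    rw [mem_coordSph_zero] at hx
    refine ⟨(), ?_⟩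
    rcases lt_or_gt_of_ne hx with h | h
    · refine ⟨-x, ?_, (antip_iff _ _).2 (Or.inr (by simp))⟩
      change 0 < 1 * ((-x : Sphere3) : EuclSp 4) 0
      rw [neg_coe_apply]
      linarith
    · refine ⟨x, ?_, rfl⟩
      change 0 < 1 * (x : EuclSp 4) 0
      linarith
  · intro ε y hy h
    rw [mem_coordSph_zero] at h
    have hy' : 0 < 1 * (y : EuclSp 4) 0 := hy
    rw [h] at hy'
    simp at hy'
  · intros; rfl

/-- Identification of a product of coordinate spaces with `ℝ³`. -/
def toR3 (ι κ : Type) [Fintype ι] [Fintype κ] (τ : ι ⊕ κ ≃ Fin 3) :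
    ((ι → ℝ) × (κ → ℝ)) ≃ₜ R3 where
  toFun z := fun j => Sum.elim z.1 z.2 (τ.symm j)
  invFun w := (fun i => w (τ (Sum.inl i)), fun i => w (τ (Sum.inr i)))
  left_inv z := by simp
  right_inv w := by
    funext j
    obtain ⟨s, rfl⟩ := τ.surjective j
    rcases s with i | i <;> simp
  continuous_toFun := by
    apply continuous_pi
    intro j
    rcases τ.symm j with i | i <;> simp only [Sum.elim_inl, Sum.elim_inr] <;> fun_prop
  continuous_invFun := by fun_prop

theorem sc_S2S1 : sc (Sphere2 × Circle1) = 0 := by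
  refine main_cover (X := Sphere2 × Circle1) id continuous_id IsOpenMap.id Function.surjective_id
    {z | z.1 ∈ coordSph 2 {0} ∨ z.2 ∈ coordSph 1 {0}}
    (((coordSph_closed _ _).preimage continuous_fst).union
      ((coordSph_closed _ _).preimage continuous_snd))
    ⟨(basisPt 2 1, basisPt 1 0), Or.inl (mem_coordSph_zero.2 (basisPt_ne (by decide)))⟩
    (by rintro a b rfl h; exact h) (fun x _ => ⟨univ, isOpen_univ, mem_univ _, Set.injOn_id _⟩)
    (Fin 2 ⊕ Fin 1) (by simp) ?_ (Sgn × Sgn)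
    (fun ε => ((hemi 2 0 ε.1.1 ε.1.2).prod (hemi 1 0 ε.2.1 ε.2.2)).trans
      (toR3 (Fin 2) (Fin 1) finSumFinEquiv).toOpenPartialHomeomorph)
    ?_ (fun _ => Set.injOn_id _) ?_ ?_ ?_
  · rintro ⟨x, y⟩ _
    obtain ⟨A, hA, h⟩ := WL_sphere 2 {0} x
    obtain ⟨B, hB, h'⟩ := WL_sphere 1 {0} y
    refine ⟨A.disjSum B, ?_, h.prod h'⟩
    rw [Finset.card_disjSum]
    simp at hA hB
    omega
  · intro ε
    have h1 : (hemi 2 0 ε.1.1 ε.1.2).target = univ := rfl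
    have h2 : (hemi 1 0 ε.2.1 ε.2.2).target = univ := rfl
    simp [h1, h2]
  · rintro ⟨x, y⟩ hx
    rw [mem_ofPred_eq, mem_coordSph_zero, mem_coordSph_zero, not_or] at hx
    obtain ⟨ε, h⟩ := sgn_exists hx.1
    obtain ⟨δ, h'⟩ := sgn_exists hx.2
    refine ⟨(ε, δ), (x, y), ?_, rfl⟩
    simp only [OpenPartialHomeomorph.trans_source, Homeomorph.toOpenPartialHomeomorph_source,
      preimage_univ, inter_univ]
    exact ⟨h, h'⟩
  · rintro ⟨ε, δ⟩ ⟨x, y⟩ hxy h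
    simp only [OpenPartialHomeomorph.trans_source, Homeomorph.toOpenPartialHomeomorph_source,
      preimage_univ, inter_univ] at hxy
    rw [mem_ofPred_eq, mem_coordSph_zero, mem_coordSph_zero] at h
    have h1 : 0 < (ε : ℝ) * (x : EuclSp 3) 0 := hxy.1
    have h2 : 0 < (δ : ℝ) * (y : EuclSp 2) 0 := hxy.2
    rcases h with h | h
    · simp only at h
      rw [h] at h1; simp at h1
    · simp only at h
      rw [h] at h2; simp at h2
  · rintro ⟨ε, δ⟩ ⟨ε', δ'⟩ ⟨x, y⟩ hx z hz rfl
    simp only [OpenPartialHomeomorph.trans_source, Homeomorph.toOpenPartialHomeomorph_source,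
      preimage_univ, inter_univ] at hx hz
    rw [sgn_unique (ε := ε) (δ := ε') (x := (x : EuclSp 3) 0) hx.1 hz.1,
      sgn_unique (ε := δ) (δ := δ') (x := (y : EuclSp 2) 0) hx.2 hz.2]

/-! ### The twisted bundle -/

def twistG : (Sphere2 × ℝ) ≃ₜ (Sphere2 × ℝ) :=
  (Homeomorph.neg Sphere2).prodCongr (Homeomorph.addRight 1)

theorem twistG_apply (a : Sphere2 × ℝ) : twistG a = (-a.1, a.2 + 1) := rfl

theorem twistG_inv_apply (a : Sphere2 × ℝ) : twistG⁻¹ a = (-a.1, a.2 - 1) := by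
  change twistG.symm a = _
  rw [Homeomorph.symm_apply_eq, twistG_apply]
  simp

theorem twistG_zpow (k : ℤ) : ∀ a : Sphere2 × ℝ, ((twistG ^ k) a).2 = a.2 + k ∧
    (((twistG ^ k) a).1 = a.1 ∨ ((twistG ^ k) a).1 = -a.1) := by
  induction k using Int.induction_on with
  | zero => intro a; simp
  | succ n ih =>
    intro a
    rw [zpow_add_one, Homeomorph.mul_apply]
    obtain ⟨h1, h2⟩ := ih (twistG a)
    rw [twistG_apply] at *
    refine ⟨?_, ?_⟩
    · rw [h1]; push_cast; ring
    · rcases h2 with h | h <;> rw [h] <;> simp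
  | pred n ih =>
    intro a
    rw [zpow_sub_one, Homeomorph.mul_apply]
    obtain ⟨h1, h2⟩ := ih (twistG⁻¹ a)
    rw [twistG_inv_apply] at *
    refine ⟨?_, ?_⟩
    · rw [h1]; push_cast; ring
    · rcases h2 with h | h <;> rw [h] <;> simp

theorem twist_h1 (a b : Sphere2 × ℝ) (h : twistRel a b) : ∃ k : ℤ, b = (twistG ^ k) a :=
  ⟨1, by rw [zpow_one]; exact Prod.ext (Subtype.ext h.1) h.2⟩

theorem twist_h2 (a : Sphere2 × ℝ) : twistRel a (twistG a) := ⟨rfl, rfl⟩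

theorem twist_iff (a b : Sphere2 × ℝ) :
    Quot.mk twistRel a = Quot.mk twistRel b ↔ ∃ k : ℤ, b = (twistG ^ k) a :=
  quot_iff twistRel twistG twist_h1 twist_h2 a b

theorem twist_eq {a b : Sphere2 × ℝ} (h : Quot.mk twistRel a = Quot.mk twistRel b)
    {c : ℝ} (ha : a.2 ∈ Ioo c (c + 1)) (hb : b.2 ∈ Ioo c (c + 1)) : a = b := by
  obtain ⟨k, rfl⟩ := (twist_iff a b).1 h
  have h1 := (twistG_zpow k a).1
  rw [h1] at hb
  have l1 : (-1 : ℝ) < k := by linarith [ha.2, hb.1]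
  have l2 : (k : ℝ) < 1 := by linarith [ha.1, hb.2]
  have l1' : -1 < k := by exact_mod_cast l1
  have l2' : k < 1 := by exact_mod_cast l2
  have : k = 0 := by omega
  subst this
  simp

def intvChart : OpenPartialHomeomorph ℝ (Unit → ℝ) :=
  (OpenPartialHomeomorph.univBall (1 / 2 : ℝ) (1 / 2)).symm.trans
    (Homeomorph.funUnique Unit ℝ).symm.toOpenPartialHomeomorph

theorem intvChart_source : intvChart.source = Ioo (0 : ℝ) (0 + 1) := by
  have : (OpenPartialHomeomorph.univBall (1 / 2 : ℝ) (1 / 2)).target = Ioo (0 : ℝ) (0 + 1) := by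
    rw [OpenPartialHomeomorph.univBall_target _ (by norm_num), Real.ball_eq_Ioo]
    norm_num
  simp only [intvChart, OpenPartialHomeomorph.trans_source, OpenPartialHomeomorph.symm_source, this,
    Homeomorph.toOpenPartialHomeomorph_source, preimage_univ, inter_univ]

theorem intvChart_target : intvChart.target = univ := by
  simp [intvChart]

theorem sc_twisted : sc TwistedS2S1 = 0 := by
  have hsrc : ∀ ε : Sgn, (((hemi 2 0 ε.1 ε.2).prod intvChart).trans
      (toR3 (Fin 2) Unit (Fintype.equivOfCardEq (by simp))).toOpenPartialHomeomorph).source =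
      {z | 0 < (ε : ℝ) * (z.1 : EuclSp 3) 0 ∧ z.2 ∈ Ioo (0 : ℝ) (0 + 1)} := by
    intro ε
    simp only [OpenPartialHomeomorph.trans_source, Homeomorph.toOpenPartialHomeomorph_source,
      preimage_univ, inter_univ, OpenPartialHomeomorph.prod_source, intvChart_source]
    rfl
  have hcl : IsClosed (range (fun n : ℤ => (n : ℝ))) := Int.isClosedEmbedding_coe_real.isClosed_range
  refine main_cover (X := Sphere2 × ℝ) (Quot.mk twistRel) continuous_quot_mk
    (quot_open twistRel twistG twist_h1 twist_h2) Quot.mk_surjective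
    {z | z.1 ∈ coordSph 2 {0} ∨ z.2 ∈ range (fun n : ℤ => (n : ℝ))}
    (((coordSph_closed _ _).preimage continuous_fst).union (hcl.preimage continuous_snd))
    ⟨(basisPt 2 1, 0), Or.inl (mem_coordSph_zero.2 (basisPt_ne (by decide)))⟩
    ?_ ?_
    (Fin 2 ⊕ Unit) (by simp) ?_ Sgn
    (fun ε => ((hemi 2 0 ε.1 ε.2).prod intvChart).trans
      (toR3 (Fin 2) Unit (Fintype.equivOfCardEq (by simp))).toOpenPartialHomeomorph)
    ?_ ?_ ?_ ?_ ?_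
  · rintro a b hab ha
    obtain ⟨k, rfl⟩ := (twist_iff a b).1 hab
    obtain ⟨h1, h2⟩ := twistG_zpow k a
    rw [mem_ofPred_eq, mem_coordSph_zero] at ha ⊢
    rcases ha with ha | ⟨m, hm⟩
    · left
      rcases h2 with h2 | h2
      · rw [h2]; exact ha
      · rw [h2, neg_coe_apply, ha, neg_zero]
    · right
      simp only at hm
      exact ⟨m + k, by rw [h1, ← hm]; push_cast; rfl⟩
  · rintro ⟨x, t⟩ _
    refine ⟨{z | z.2 ∈ Ioo (t - 1 / 2) (t - 1 / 2 + 1)}, isOpen_Ioo.preimage continuous_snd, ?_, ?_⟩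
    · constructor <;> simp only <;> linarith
    · intro a ha b hb h
      exact twist_eq h ha hb
  · rintro ⟨x, y⟩ _
    obtain ⟨A, hA, h⟩ := WL_sphere 2 {0} x
    obtain ⟨B, hB, h'⟩ := WL_int y
    refine ⟨A.disjSum B, ?_, h.prod h'⟩
    rw [Finset.card_disjSum]
    simp only [Finset.card_singleton] at hA
    omega
  · intro ε
    have h1 : (hemi 2 0 ε.1 ε.2).target = univ := rfl
    simp [h1, intvChart_target]
  · intro ε a ha b hb h
    rw [hsrc] at ha hb
    exact twist_eq h ha.2 hb.2
  · rintro ⟨x, t⟩ hx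
    rw [mem_ofPred_eq, mem_coordSph_zero, not_or] at hx
    obtain ⟨h1, h2⟩ := twistG_zpow (-⌊t⌋) (x, t)
    have hne : (((twistG ^ (-⌊t⌋)) (x, t)).1 : EuclSp 3) 0 ≠ 0 := by
      rcases h2 with h2 | h2
      · rw [h2]; exact hx.1
      · rw [h2, neg_coe_apply]; exact neg_ne_zero.2 hx.1
    obtain ⟨ε, h⟩ := sgn_exists hne
    refine ⟨ε, (twistG ^ (-⌊t⌋)) (x, t), ?_, ?_⟩
    · rw [hsrc]
      refine ⟨h, ?_⟩
      rw [h1]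
      have h3 : (⌊t⌋ : ℝ) ≠ t := fun h => hx.2 ⟨_, h⟩
      have h4 := lt_of_le_of_ne (Int.floor_le t) h3
      have h5 := Int.lt_floor_add_one t
      push_cast
      constructor <;> linarith
    · exact ((twist_iff _ _).2 ⟨_, rfl⟩).symm
  · rintro ε ⟨x, t⟩ hxt h
    rw [hsrc] at hxt
    rw [mem_ofPred_eq, mem_coordSph_zero] at h
    obtain ⟨h1, h2, h3⟩ := hxt
    rcases h with h | ⟨m, h⟩
    · simp only at h h1
      rw [h] at h1; simp at h1
    · simp only at h h2 h3
      subst h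
      have h2' : 0 < m := by exact_mod_cast h2
      have h3' : m < 0 + 1 := by exact_mod_cast h3
      omega
  · rintro ε δ a ha b hb h
    rw [hsrc] at ha hb
    have := twist_eq h ha.2 hb.2
    subst this
    exact sgn_unique ha.1 hb.1

end

noncomputable section

/-! ### The lens space -/

abbrev C2 : Type := EuclideanSpace ℂ (Fin 2)

theorem sphere3_sum (a : Sphere3) : (a : EuclSp 4) 0 ^ 2 + (a : EuclSp 4) 1 ^ 2 +
    (a : EuclSp 4) 2 ^ 2 + (a : EuclSp 4) 3 ^ 2 = 1 := by
  have h := a.2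
  rw [mem_sphere_zero_iff_norm, EuclideanSpace.norm_eq, Real.sqrt_eq_one,
    Fin.sum_univ_four] at h
  simpa only [Real.norm_eq_abs, sq_abs] using h

theorem sphereC_sum (a : SphereC) : ((a : C2) 0).re ^ 2 + ((a : C2) 0).im ^ 2 +
    ((a : C2) 1).re ^ 2 + ((a : C2) 1).im ^ 2 = 1 := by
  have h := a.2
  rw [mem_sphere_zero_iff_norm, EuclideanSpace.norm_eq, Real.sqrt_eq_one,
    Fin.sum_univ_two, Complex.sq_norm, Complex.sq_norm, Complex.normSq_apply,
    Complex.normSq_apply] at h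
  linarith

/-- The identification of the real and the complex 3-sphere. -/
def realToC : Sphere3 ≃ₜ SphereC where
  toFun a := ⟨WithLp.toLp 2 ![⟨(a : EuclSp 4) 0, (a : EuclSp 4) 1⟩,
      ⟨(a : EuclSp 4) 2, (a : EuclSp 4) 3⟩], by
    rw [mem_sphere_zero_iff_norm, EuclideanSpace.norm_eq, Real.sqrt_eq_one,
      Fin.sum_univ_two, Complex.sq_norm, Complex.sq_norm, Complex.normSq_apply,
      Complex.normSq_apply]
    have := sphere3_sum a
    simp
    linarith⟩
  invFun w := ⟨WithLp.toLp 2 ![((w : C2) 0).re, ((w : C2) 0).im, ((w : C2) 1).re,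
      ((w : C2) 1).im], by
    rw [mem_sphere_zero_iff_norm, EuclideanSpace.norm_eq, Real.sqrt_eq_one,
      Fin.sum_univ_four]
    have := sphereC_sum w
    simp
    linarith⟩
  left_inv a := by
    apply Subtype.ext
    ext i
    fin_cases i <;> rfl
  right_inv w := by
    apply Subtype.ext
    ext i
    fin_cases i <;> rfl
  continuous_toFun := by
    apply Continuous.subtype_mk
    apply (PiLp.continuous_toLp 2 _).comp
    apply continuous_pi
    intro i
    fin_cases i
    · exact Complex.equivRealProdCLM.symm.continuous.comp
        (f := fun a : Sphere3 => ((a : EuclSp 4) 0, (a : EuclSp 4) 1)) (by fun_prop)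
    · exact Complex.equivRealProdCLM.symm.continuous.comp
        (f := fun a : Sphere3 => ((a : EuclSp 4) 2, (a : EuclSp 4) 3)) (by fun_prop)
  continuous_invFun := by
    apply Continuous.subtype_mk
    apply (PiLp.continuous_toLp 2 _).comp
    apply continuous_pi
    intro i
    fin_cases i
    · exact Complex.continuous_re.comp (f := fun w : SphereC => (w : C2) 0) (by fun_prop)
    · exact Complex.continuous_im.comp (f := fun w : SphereC => (w : C2) 0) (by fun_prop)
    · exact Complex.continuous_re.comp (f := fun w : SphereC => (w : C2) 1) (by fun_prop)
    · exact Complex.continuous_im.comp (f := fun w : SphereC => (w : C2) 1) (by fun_prop)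

theorem realToC_zero (a : Sphere3) :
    (realToC a : C2) 0 = ⟨(a : EuclSp 4) 0, (a : EuclSp 4) 1⟩ := rfl

theorem realToC_one (a : Sphere3) :
    (realToC a : C2) 1 = ⟨(a : EuclSp 4) 2, (a : EuclSp 4) 3⟩ := rfl

/-- Multiplication by `i`. -/
def lensG : SphereC ≃ₜ SphereC where
  toFun w := ⟨Complex.I • (w : C2), by
    rw [mem_sphere_zero_iff_norm, norm_smul, mem_sphere_zero_iff_norm.1 w.2]; simp⟩
  invFun w := ⟨(-Complex.I) • (w : C2), by
    rw [mem_sphere_zero_iff_norm, norm_smul, mem_sphere_zero_iff_norm.1 w.2]; simp⟩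
  left_inv w := by
    apply Subtype.ext
    simp [smul_smul]
  right_inv w := by
    apply Subtype.ext
    simp [smul_smul]
  continuous_toFun := by
    apply Continuous.subtype_mk
    fun_prop
  continuous_invFun := by
    apply Continuous.subtype_mk
    fun_prop

theorem lensG_pow (n : ℕ) : ∀ w : SphereC, ((lensG ^ n) w : C2) = Complex.I ^ n • (w : C2) := by
  induction n with
  | zero => intro w; simp
  | succ n ih =>
    intro w
    rw [pow_succ, Homeomorph.mul_apply, ih]
    change Complex.I ^ n • (Complex.I • (w : C2)) = _
    rw [smul_smul, pow_succ]

theorem lensG_four : lensG ^ 4 = 1 := by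
  ext1 w
  apply Subtype.ext
  rw [lensG_pow, Complex.I_pow_four, one_smul]
  rfl

theorem lensG_zpow (k : ℤ) : ∃ n : ℕ, n < 4 ∧ lensG ^ k = lensG ^ n := by
  refine ⟨(k % 4).toNat, by omega, ?_⟩
  rw [← zpow_natCast]
  have h : ((k % 4).toNat : ℤ) = k % 4 := by omega
  rw [h]
  conv_lhs => rw [← Int.emod_add_mul_ediv k 4, zpow_add, zpow_mul]
  have : lensG ^ (4 : ℤ) = 1 := by rw [zpow_ofNat]; exact lensG_four
  rw [this, one_zpow, mul_one]

theorem exp_lens (k : ℕ) : Complex.exp (2 * Real.pi * Complex.I * k / (4 : ℕ)) = Complex.I ^ k := by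
  have : (2 * Real.pi * Complex.I * k / (4 : ℕ) : ℂ) = k * (Real.pi / 2 * Complex.I) := by
    push_cast; ring
  rw [this, Complex.exp_nat_mul, Complex.exp_pi_div_two_mul_I]

theorem lens_iff_pow (x y : SphereC) : lensRel 4 1 x y ↔ ∃ k : ℕ, y = (lensG ^ k) x := by
  unfold lensRel
  apply exists_congr
  intro k
  have h1 : Complex.exp (2 * Real.pi * Complex.I * (k * (1 : ℕ)) / (4 : ℕ)) = Complex.I ^ k := by
    rw [← exp_lens k]; simp
  rw [h1, exp_lens k]
  constructor
  · rintro ⟨h0, h1⟩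
    apply Subtype.ext
    rw [lensG_pow]
    ext i
    fin_cases i
    · exact h0
    · exact h1
  · intro h
    rw [h, lensG_pow]
    exact ⟨rfl, rfl⟩

theorem lens_h1 (a b : SphereC) (h : lensRel 4 1 a b) : ∃ k : ℤ, b = (lensG ^ k) a := by
  obtain ⟨k, hk⟩ := (lens_iff_pow a b).1 h
  exact ⟨k, by rw [zpow_natCast]; exact hk⟩

theorem lens_h2 (a : SphereC) : lensRel 4 1 a (lensG a) :=
  (lens_iff_pow _ _).2 ⟨1, by rw [pow_one]⟩

/-- The covering of `L(4,1)` by the real 3-sphere. -/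
def lensP (a : Sphere3) : Lens 4 1 := Quot.mk (lensRel 4 1) (realToC a)

theorem lensP_iff (a b : Sphere3) :
    lensP a = lensP b ↔ ∃ k : ℤ, realToC b = (lensG ^ k) (realToC a) :=
  quot_iff (lensRel 4 1) lensG lens_h1 lens_h2 _ _

theorem lensP_cases {a b : Sphere3} (h : lensP a = lensP b) :
    a = b ∨
    ((b : EuclSp 4) 0 = -(a : EuclSp 4) 1 ∧ (b : EuclSp 4) 1 = (a : EuclSp 4) 0 ∧
      (b : EuclSp 4) 2 = -(a : EuclSp 4) 3 ∧ (b : EuclSp 4) 3 = (a : EuclSp 4) 2) ∨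
    ((b : EuclSp 4) 0 = -(a : EuclSp 4) 0 ∧ (b : EuclSp 4) 1 = -(a : EuclSp 4) 1 ∧
      (b : EuclSp 4) 2 = -(a : EuclSp 4) 2 ∧ (b : EuclSp 4) 3 = -(a : EuclSp 4) 3) ∨
    ((b : EuclSp 4) 0 = (a : EuclSp 4) 1 ∧ (b : EuclSp 4) 1 = -(a : EuclSp 4) 0 ∧
      (b : EuclSp 4) 2 = (a : EuclSp 4) 3 ∧ (b : EuclSp 4) 3 = -(a : EuclSp 4) 2) := by
  obtain ⟨k, hk⟩ := (lensP_iff a b).1 h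
  obtain ⟨n, hn, hkn⟩ := lensG_zpow k
  rw [hkn] at hk
  have h2 := congrArg Subtype.val hk
  rw [lensG_pow] at h2
  have e0 : (realToC b : C2) 0 = Complex.I ^ n * (realToC a : C2) 0 := by rw [h2]; rfl
  have e1 : (realToC b : C2) 1 = Complex.I ^ n * (realToC a : C2) 1 := by rw [h2]; rfl
  rw [realToC_zero, realToC_zero, Complex.ext_iff] at e0
  rw [realToC_one, realToC_one, Complex.ext_iff] at e1
  interval_cases n
  · left
    apply realToC.injective
    rw [hk]; simp
  · right; left
    simp at e0 e1
    exact ⟨e0.1, e0.2, e1.1, e1.2⟩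
  · right; right; left
    simp at e0 e1
    exact ⟨e0.1, e0.2, e1.1, e1.2⟩
  · right; right; right
    have h3 : Complex.I ^ 3 = -Complex.I := Complex.I_pow_three
    simp [h3] at e0 e1
    exact ⟨e0.1, e0.2, e1.1, e1.2⟩

theorem lensP_rot (a : Sphere3) : ∃ b : Sphere3, lensP b = lensP a ∧
    (b : EuclSp 4) 2 = -(a : EuclSp 4) 3 ∧ (b : EuclSp 4) 3 = (a : EuclSp 4) 2 := by
  refine ⟨realToC.symm (lensG (realToC a)), ?_, ?_⟩
  · symm
    rw [lensP_iff]
    exact ⟨1, by simp⟩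
  · have h : realToC (realToC.symm (lensG (realToC a))) = lensG (realToC a) := by simp
    have e1 : (realToC (realToC.symm (lensG (realToC a))) : C2) 1
      = Complex.I * (realToC a : C2) 1 := by rw [h]; rfl
    rw [realToC_one, realToC_one, Complex.ext_iff] at e1
    simp only [Complex.mul_re, Complex.mul_im, Complex.I_re, Complex.I_im] at e1
    constructor <;> linarith [e1.1, e1.2]

theorem lensP_quadrant (a : Sphere3) (h2 : (a : EuclSp 4) 2 ≠ 0) (h3 : (a : EuclSp 4) 3 ≠ 0) :
    ∃ b : Sphere3, lensP b = lensP a ∧ 0 < (b : EuclSp 4) 2 ∧ 0 < (b : EuclSp 4) 3 := by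
  obtain ⟨b, hb, b2, b3⟩ := lensP_rot a
  obtain ⟨c, hc, c2, c3⟩ := lensP_rot b
  obtain ⟨d, hd, d2, d3⟩ := lensP_rot c
  rcases lt_or_gt_of_ne h2 with g2 | g2 <;> rcases lt_or_gt_of_ne h3 with g3 | g3
  · exact ⟨c, hc.trans hb, by linarith, by linarith⟩
  · exact ⟨d, hd.trans (hc.trans hb), by linarith, by linarith⟩
  · exact ⟨b, hb, by linarith, by linarith⟩
  · exact ⟨a, rfl, g2, g3⟩

/-- The logarithm in the last coordinate, from a half-space to the whole space. -/
def logChart : OpenPartialHomeomorph R3 R3 where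
  toFun y := ![y 0, y 1, Real.log (y 2)]
  invFun y := ![y 0, y 1, Real.exp (y 2)]
  source := {y | 0 < y 2}
  target := univ
  map_source' _ _ := mem_univ _
  map_target' y _ := Real.exp_pos (y 2)
  left_inv' y hy := by
    have hy' : 0 < y 2 := hy
    ext i
    fin_cases i
    · rfl
    · rfl
    · exact Real.exp_log hy'
  right_inv' y _ := by
    ext i
    fin_cases i
    · rfl
    · rfl
    · exact Real.log_exp _
  open_source := isOpen_lt continuous_const (continuous_apply 2)
  open_target := isOpen_univ
  continuousOn_toFun := by
    apply continuousOn_pi.2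
    intro i
    fin_cases i
    · exact (continuous_apply 0).continuousOn
    · exact (continuous_apply 1).continuousOn
    · exact (continuous_apply 2).continuousOn.log (fun y hy => ne_of_gt hy)
  continuousOn_invFun := by
    apply Continuous.continuousOn
    apply continuous_pi
    intro i
    fin_cases i
    · exact continuous_apply 0
    · exact continuous_apply 1
    · exact Real.continuous_exp.comp (continuous_apply 2)

def quadChart : OpenPartialHomeomorph Sphere3 R3 := (hemi 3 2 1 (by norm_num)).trans logChart

theorem quadChart_target : quadChart.target = univ := by
  have h1 : (hemi 3 2 1 (by norm_num)).target = univ := rfl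
  have h2 : logChart.target = univ := rfl
  simp [quadChart, h1, h2]

theorem quadChart_source (x : Sphere3) :
    x ∈ quadChart.source ↔ 0 < (x : EuclSp 4) 2 ∧ 0 < (x : EuclSp 4) 3 := by
  have h : x ∈ quadChart.source ↔ 0 < 1 * (x : EuclSp 4) 2 ∧
      0 < (x : EuclSp 4) 3 / (x : EuclSp 4) 2 := Iff.rfl
  rw [h, one_mul]
  constructor
  · rintro ⟨h1, h2⟩
    exact ⟨h1, (div_pos_iff_of_pos_right h1).1 h2⟩
  · rintro ⟨h1, h2⟩
    exact ⟨h1, div_pos h2 h1⟩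

theorem mem_coordSph_lens {x : Sphere3} :
    x ∈ coordSph 3 {2, 3} ↔ (x : EuclSp 4) 2 = 0 ∨ (x : EuclSp 4) 3 = 0 := by
  simp [coordSph]

theorem sc_lens : sc (Lens 4 1) = 0 := by
  refine main_cover (X := Sphere3) lensP (continuous_quot_mk.comp realToC.continuous)
    ((quot_open (lensRel 4 1) lensG lens_h1 lens_h2).comp realToC.isOpenMap)
    (Quot.mk_surjective.comp realToC.surjective)
    (coordSph 3 {2, 3}) (coordSph_closed _ _)
    ⟨basisPt 3 0, mem_coordSph_lens.2 (Or.inl (basisPt_ne (by decide)))⟩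
    ?_ ?_
    (Fin 3) (by simp) ?_ Unit (fun _ => quadChart) (fun _ => quadChart_target)
    ?_ ?_ ?_ ?_
  · intro a b hab ha
    rw [mem_coordSph_lens] at ha ⊢
    rcases lensP_cases hab with rfl | ⟨-, -, h2, h3⟩ | ⟨-, -, h2, h3⟩ | ⟨-, -, h2, h3⟩
    · exact ha
    all_goals
      rw [h2, h3]
      simp only [neg_eq_zero]
      tauto
  · intro x _
    refine ⟨Metric.ball x (1 / 2), Metric.isOpen_ball, Metric.mem_ball_self (by norm_num), ?_⟩
    intro a ha b hb hab
    have hd : dist a b < 1 := by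
      have := dist_triangle_right a b x
      rw [Metric.mem_ball] at ha hb
      linarith
    rw [Subtype.dist_eq, EuclideanSpace.dist_eq, Real.sqrt_lt' one_pos, Fin.sum_univ_four] at hd
    simp only [Real.dist_eq, sq_abs] at hd
    have hs := sphere3_sum a
    rcases lensP_cases hab with h | ⟨h0, h1, h2, h3⟩ | ⟨h0, h1, h2, h3⟩ | ⟨h0, h1, h2, h3⟩
    · exact h
    all_goals
      exfalso
      rw [h0, h1, h2, h3] at hd
      nlinarith
  · intro x _
    obtain ⟨A, hA, h⟩ := WL_sphere 3 {2, 3} x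
    exact ⟨A, hA.trans (by decide), h⟩
  · intro _ a ha b hb hab
    rw [quadChart_source] at ha hb
    rcases lensP_cases hab with h | ⟨h0, h1, h2, h3⟩ | ⟨h0, h1, h2, h3⟩ | ⟨h0, h1, h2, h3⟩
    · exact h
    all_goals
      exfalso
      linarith [ha.1, ha.2, hb.1, hb.2]
  · intro x hx
    rw [mem_coordSph_lens, not_or] at hx
    obtain ⟨b, hb, h2, h3⟩ := lensP_quadrant x hx.1 hx.2
    exact ⟨(), b, (quadChart_source b).2 ⟨h2, h3⟩, hb⟩
  · intro _ y hy h
    rw [quadChart_source] at hy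
    rw [mem_coordSph_lens] at h
    rcases h with h | h
    · exact hy.1.ne' h
    · exact hy.2.ne' h
  · intros; rfl

end

/-- `S³`, `ℝP³`, `S² × S¹`, `S² ×~ S¹` and `L(4,1)` have
surface-complexity zero. -/
theorem sc_zero_examples :
    sc Sphere3 = 0 ∧ sc (RP 3) = 0 ∧ sc (Sphere2 × Circle1) = 0 ∧
    sc TwistedS2S1 = 0 ∧ sc (Lens 4 1) = 0 := by
  exact ⟨sc_sphere, sc_RP3, sc_S2S1, sc_twisted, sc_lens⟩
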